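/- arXiv:1308.2281 — 11 statements merged into one kernel-verified Lean document; each statement's English description precedes it below -/
import Mathlib

section
/- Let p, q ≥ 3 be odd integers. Then the determinant of the distance matrix of G(p,q;0) = ∞(p,1,q) equals (pq−1)(p+q)/4. -/
open SimpleGraph Matrix

/-- The distance matrix of a graph, with entries in `ℚ`: the `(i,j)` entry is the
graph distance (length of a shortest path) between `i` and `j`. -/
noncomputable def distMatrix {V : Type*} (G : SimpleGraph V) : Matrix V V ℚ :=
  fun i j => (G.dist i j : ℚ)

/-- The graph `G(p,q;n)` on `Fin (p+q-1+n)`: the graph `∞(p,1,q)` — the cycle `C_p`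
on `0, …, p-1` and the cycle `C_q` on `0, p, …, p+q-2`, sharing the center vertex
`0` — together with a pendant path `0, p+q-1, p+q, …, p+q-2+n` on `n` new vertices
planted at the center vertex.  In particular `G(p,q;0) = ∞(p,1,q)`. -/
def Gpq (p q n : ℕ) : SimpleGraph (Fin (p + q - 1 + n)) :=
  SimpleGraph.fromRel (fun a b =>
    ((a : ℕ) + 1 = (b : ℕ) ∧ (b : ℕ) < p) ∨
    ((a : ℕ) = 0 ∧ (b : ℕ) = p - 1) ∨
    ((a : ℕ) = 0 ∧ (b : ℕ) = p) ∨
    (p ≤ (a : ℕ) ∧ (a : ℕ) + 1 = (b : ℕ) ∧ (b : ℕ) ≤ p + q - 2) ∨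
    ((a : ℕ) = 0 ∧ (b : ℕ) = p + q - 2) ∨
    (1 ≤ n ∧ (a : ℕ) = 0 ∧ (b : ℕ) = p + q - 1) ∨
    (p + q - 1 ≤ (a : ℕ) ∧ (a : ℕ) + 1 = (b : ℕ)))

theorem SimpleGraph.dist_eq_of_isLocal {V : Type*} (G : SimpleGraph V) (d : V → V → ℕ)
    (h0 : ∀ a, d a a = 0)
    (hle : ∀ a b c, G.Adj b c → d a c ≤ d a b + 1)
    (hex : ∀ a b, a ≠ b → ∃ c, G.Adj c b ∧ d a c + 1 = d a b) (a b : V) :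
    G.dist a b = d a b := by
  have hwalk : ∀ n b, d a b = n → ∃ w : G.Walk a b, w.length = n := by
    intro n
    induction n with
    | zero =>
      intro b hb
      by_cases hab : a = b
      · subst hab
        exact ⟨.nil, rfl⟩
      · obtain ⟨c, -, hc⟩ := hex a b hab
        omega
    | succ n ih =>
      intro b hb
      have hab : a ≠ b := by
        rintro rfl
        have := h0 a
        omega
      obtain ⟨c, hcb, hc⟩ := hex a b hab
      obtain ⟨w, hw⟩ := ih c (by omega)
      exact ⟨w.concat hcb, by simp [hw]⟩
  obtain ⟨w, hw⟩ := hwalk _ b rfl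
  have hlow : ∀ {u v : V} (w : G.Walk u v), d a v ≤ d a u + w.length := by
    intro u v w
    induction w with
    | nil => simp
    | cons h w ih =>
      have := hle a _ _ h
      simp only [Walk.length_cons]
      omega
  obtain ⟨w', hw'⟩ := w.reachable.exists_walk_length_eq_dist
  have h1 := hlow w'
  have h2 := SimpleGraph.dist_le w
  have h3 := h0 a
  omega

/-- Distance between the positions `i` and `j` on a cycle of length `p`. -/
def cycleDist (p i j : ℕ) : ℕ := min ((i - j) + (j - i)) (p - ((i - j) + (j - i)))

/-- Neighbouring positions on a cycle of length `p`. -/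
def CycleNbr (p i j : ℕ) : Prop :=
  i + 1 = j ∨ j + 1 = i ∨ (i = 0 ∧ j = p - 1) ∨ (j = 0 ∧ i = p - 1)

theorem cycleDist_le_succ {p i j k : ℕ} (hi : i < p) (hj : j < p) (hk : k < p)
    (h : CycleNbr p j k) : cycleDist p i k ≤ cycleDist p i j + 1 := by
  rcases h with h | h | h | h <;> simp only [cycleDist] <;> omega

theorem exists_cycleNbr_cycleDist {p i j : ℕ} (hp : 3 ≤ p) (hi : i < p) (hj : j < p)
    (hij : i ≠ j) : ∃ k < p, k ≠ j ∧ CycleNbr p k j ∧ cycleDist p i k + 1 = cycleDist p i j := by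
  by_cases hup : (i < j ∧ p - (j - i) < j - i) ∨ (j < i ∧ i - j ≤ p - (i - j))
  · by_cases hj1 : j = p - 1
    · refine ⟨0, by omega, by omega, Or.inr (Or.inr (Or.inl ⟨rfl, hj1⟩)), ?_⟩
      simp only [cycleDist]
      omega
    · refine ⟨j + 1, by omega, by omega, Or.inr (Or.inl rfl), ?_⟩
      simp only [cycleDist]
      omega
  · by_cases hj1 : j = 0
    · refine ⟨p - 1, by omega, by omega, Or.inr (Or.inr (Or.inr ⟨hj1, rfl⟩)), ?_⟩
      simp only [cycleDist]
      omega
    · refine ⟨j - 1, by omega, by omega, Or.inl (by omega), ?_⟩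
      simp only [cycleDist]
      omega

/-- Position on the first cycle of `∞(p,1,q)` closest to the vertex `a`. -/
def fstPos (p a : ℕ) : ℕ := if a < p then a else 0

/-- Position on the second cycle of `∞(p,1,q)` closest to the vertex `a`. -/
def sndPos (p a : ℕ) : ℕ := a - (p - 1)

theorem adj_Gpq_zero_iff {p q : ℕ} (hp : 3 ≤ p) (hq : 3 ≤ q) (a b : Fin (p + q - 1 + 0)) :
    (Gpq p q 0).Adj a b ↔ (a : ℕ) ≠ b ∧
      ((sndPos p a = 0 ∧ sndPos p b = 0 ∧ CycleNbr p (fstPos p a) (fstPos p b)) ∨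
        (fstPos p a = 0 ∧ fstPos p b = 0 ∧ CycleNbr q (sndPos p a) (sndPos p b))) := by
  obtain ⟨a, ha⟩ := a
  obtain ⟨b, hb⟩ := b
  simp only [Gpq, SimpleGraph.fromRel_adj, fstPos, sndPos, CycleNbr, ne_eq, Fin.mk.injEq]
  refine and_congr_right fun hab => ⟨?_, ?_⟩
  · rintro ((h | h | h | h | h | h | h) | (h | h | h | h | h | h | h)) <;>
      split_ifs <;> omega
  · rintro (⟨h1, h2, h⟩ | ⟨h1, h2, h⟩)
    · rw [if_pos (by omega), if_pos (by omega)] at h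
      rcases h with h | h | h | h
      · exact Or.inl (Or.inl (by omega))
      · exact Or.inr (Or.inl (by omega))
      · exact Or.inl (Or.inr (Or.inl (by omega)))
      · exact Or.inr (Or.inr (Or.inl (by omega)))
    · have h1 : a = 0 ∨ p ≤ a := by split_ifs at h1 <;> omega
      have h2 : b = 0 ∨ p ≤ b := by split_ifs at h2 <;> omega
      rcases h with h | h | h | h
      · by_cases h0 : a = 0
        · exact Or.inl (Or.inr (Or.inr (Or.inl (by omega))))
        · exact Or.inl (Or.inr (Or.inr (Or.inr (Or.inl (by omega)))))
      · by_cases h0 : b = 0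
        · exact Or.inr (Or.inr (Or.inr (Or.inl (by omega))))
        · exact Or.inr (Or.inr (Or.inr (Or.inr (Or.inl (by omega)))))
      · exact Or.inl (Or.inr (Or.inr (Or.inr (Or.inr (Or.inl (by omega))))))
      · exact Or.inr (Or.inr (Or.inr (Or.inr (Or.inr (Or.inl (by omega))))))

theorem fstPos_lt {p : ℕ} (hp : 3 ≤ p) (a : ℕ) : fstPos p a < p := by
  simp only [fstPos]
  split_ifs <;> omega

theorem sndPos_lt {p q a : ℕ} (hp : 3 ≤ p) (hq : 3 ≤ q) (ha : a < p + q - 1 + 0) :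
    sndPos p a < q := by
  simp only [sndPos]
  omega

theorem cycleDist_self (p i : ℕ) : cycleDist p i i = 0 := by
  simp [cycleDist]

theorem dist_Gpq_zero {p q : ℕ} (hp : 3 ≤ p) (hq : 3 ≤ q) (a b : Fin (p + q - 1 + 0)) :
    (Gpq p q 0).dist a b =
      cycleDist p (fstPos p a) (fstPos p b) + cycleDist q (sndPos p a) (sndPos p b) := by
  refine SimpleGraph.dist_eq_of_isLocal _ (fun a b : Fin (p + q - 1 + 0) =>
    cycleDist p (fstPos p a) (fstPos p b) + cycleDist q (sndPos p a) (sndPos p b)) ?_ ?_ ?_ a b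
  · intro a
    simp [cycleDist_self]
  · intro a b c h
    obtain ⟨-, ⟨h1, h2, h⟩ | ⟨h1, h2, h⟩⟩ := (adj_Gpq_zero_iff hp hq b c).1 h
    · have := cycleDist_le_succ (fstPos_lt hp a) (fstPos_lt hp b) (fstPos_lt hp c) h
      simp only [h1, h2]
      omega
    · have := cycleDist_le_succ (sndPos_lt hp hq a.2) (sndPos_lt hp hq b.2)
        (sndPos_lt hp hq c.2) h
      simp only [h1, h2]
      omega
  · intro a b hab
    have hab : (a : ℕ) ≠ b := fun h => hab (Fin.ext h)
    by_cases h : sndPos p b = 0 ∧ fstPos p a ≠ fstPos p b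
    · obtain ⟨k, hk, hkb, hn, hd⟩ :=
        exists_cycleNbr_cycleDist hp (fstPos_lt hp a) (fstPos_lt hp b) h.2
      have hk1 : fstPos p k = k := if_pos hk
      have hk2 : sndPos p k = 0 := by simp only [sndPos]; omega
      refine ⟨⟨k, by omega⟩, (adj_Gpq_zero_iff hp hq _ _).2 ⟨?_, Or.inl ⟨hk2, h.1, ?_⟩⟩, ?_⟩
      · rintro rfl
        exact hkb hk1.symm
      · rwa [hk1]
      · simp only [hk1, hk2, h.1]
        omega
    · have h' : fstPos p b = 0 ∧ sndPos p a ≠ sndPos p b := by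
        simp only [fstPos, sndPos] at h ⊢
        split_ifs at h ⊢ <;> omega
      obtain ⟨k, hk, hkb, hn, hd⟩ :=
        exists_cycleNbr_cycleDist hq (sndPos_lt hp hq a.2) (sndPos_lt hp hq b.2) h'.2
      obtain ⟨c, hc, hc1, hc2⟩ : ∃ c < p + q - 1 + 0, fstPos p c = 0 ∧ sndPos p c = k := by
        by_cases h0 : k = 0
        · refine ⟨0, by omega, ?_, ?_⟩ <;> simp [fstPos, sndPos, h0]
        · refine ⟨p - 1 + k, by omega, if_neg (by omega), ?_⟩
          simp only [sndPos]
          omega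
      refine ⟨⟨c, hc⟩, (adj_Gpq_zero_iff hp hq _ _).2 ⟨?_, Or.inr ⟨hc1, h'.1, ?_⟩⟩, ?_⟩
      · rintro rfl
        exact hkb hc2.symm
      · rwa [hc2]
      · simp only [hc1, hc2, h'.1]
        omega

/-- Position on a cycle of length `2 * k + 1` reached from `0` after `t` jumps of length `k`. -/
def jumpPos (k t : ℕ) : ℕ :=
  if t % 2 = 0 then (if t = 0 then 0 else 2 * k + 1 - t / 2) else k - t / 2

/-- Distance on a cycle of length `2 * k + 1` between the positions reached from `0` after
`i` and `j` jumps of length `k`. -/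
def jumpDist (k i j : ℕ) : ℕ :=
  if ((i - j) + (j - i)) % 2 = 0 then ((i - j) + (j - i)) / 2
  else (2 * k + 1 - ((i - j) + (j - i))) / 2

theorem jumpPos_lt (k t : ℕ) : jumpPos k t < 2 * k + 1 := by
  simp only [jumpPos]
  split_ifs <;> omega

theorem jumpPos_pos {k t : ℕ} (ht : t < 2 * k) : 0 < jumpPos k (t + 1) := by
  unfold jumpPos
  split_ifs
  · contradiction
  · omega
  · omega

theorem jumpPos_inj {k i j : ℕ} (hi : i ≤ 2 * k) (hj : j ≤ 2 * k)
    (h : jumpPos k i = jumpPos k j) : i = j := by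
  simp only [jumpPos] at h
  split_ifs at h <;> omega

theorem cycleDist_jumpPos {k i j : ℕ} (hi : i ≤ 2 * k) (hj : j ≤ 2 * k) :
    cycleDist (2 * k + 1) (jumpPos k i) (jumpPos k j) = jumpDist k i j := by
  simp only [cycleDist, jumpPos, jumpDist]
  split_ifs <;> omega

theorem jumpDist_zero_zero (k : ℕ) : jumpDist k 0 0 = 0 := by
  simp [jumpDist]

theorem jumpDist_comm (k i j : ℕ) : jumpDist k i j = jumpDist k j i := by
  simp only [jumpDist, add_comm]

theorem jumpDist_end {k j : ℕ} (hj : j ≤ 2 * k + 1) :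
    jumpDist k (2 * k + 1) j = jumpDist k 0 j := by
  simp only [jumpDist]
  split_ifs <;> omega

theorem jumpDist_add_add {k i j : ℕ} (hi : i < 2 * k) (hj : j ≤ 2 * k) :
    jumpDist k i j + 2 * jumpDist k (i + 1) j + jumpDist k (i + 2) j +
      (if i + 1 = j then 1 else 0) = 2 * k + 1 := by
  simp only [jumpDist]
  split_ifs <;> omega

theorem sum_jumpDist {k m : ℕ} (hm : m ≤ k) :
    ∑ t ∈ Finset.range (2 * m), jumpDist k 0 (t + 1) = m * (k + 1) := by
  induction m with
  | zero => simp
  | succ m ih =>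
    have h1 : jumpDist k 0 (2 * m + 1) = k - m := by
      simp only [jumpDist]
      split_ifs <;> omega
    have h2 : jumpDist k 0 (2 * m + 1 + 1) = m + 1 := by
      simp only [jumpDist]
      split_ifs <;> omega
    rw [show 2 * (m + 1) = 2 * m + 1 + 1 by ring, Finset.sum_range_succ, Finset.sum_range_succ,
      ih (by omega), h1, h2, add_assoc, show k - m + (m + 1) = k + 1 by omega]
    ring

/-- The tridiagonal matrix with `2` on the diagonal and `1` next to it. -/
def tridiag (n : ℕ) : Matrix (Fin n) (Fin n) ℚ := fun i j =>
  (if (j : ℕ) = i then 2 else 0) + (if (j : ℕ) + 1 = i then 1 else 0) +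
    (if (j : ℕ) = i + 1 then 1 else 0)

theorem sum_tridiag_mul {n : ℕ} (f : ℕ → ℚ) (h0 : f 0 = 0) (hn : f (n + 1) = 0) (i : Fin n) :
    ∑ j : Fin n, tridiag n i j * f (j + 1) = f i + 2 * f (i + 1) + f (i + 2) := by
  obtain ⟨i, hi⟩ := i
  simp only [tridiag]
  rw [Fin.sum_univ_eq_sum_range (fun j => ((if j = i then (2 : ℚ) else 0) +
    (if j + 1 = i then 1 else 0) + (if j = i + 1 then 1 else 0)) * f (j + 1)) n]
  simp only [add_mul, Finset.sum_add_distrib, ite_mul, zero_mul, one_mul]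
  have e1 : ∑ j ∈ Finset.range n, (if j = i then 2 * f (j + 1) else 0) = 2 * f (i + 1) := by
    rw [Finset.sum_ite_eq' _ i fun j => 2 * f (j + 1), if_pos (Finset.mem_range.2 hi)]
  have e2 : ∑ j ∈ Finset.range n, (if j + 1 = i then f (j + 1) else 0) = f i := by
    cases i with
    | zero => simp [h0]
    | succ i =>
      simp only [Nat.add_right_cancel_iff]
      rw [Finset.sum_ite_eq' _ i fun j => f (j + 1), if_pos (Finset.mem_range.2 (by omega))]
  have e3 : ∑ j ∈ Finset.range n, (if j = i + 1 then f (j + 1) else 0) = f (i + 2) := by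
    rw [Finset.sum_ite_eq' _ (i + 1) fun j => f (j + 1)]
    split_ifs with h
    · rfl
    · rw [← hn, show i + 2 = n + 1 by rw [Finset.mem_range] at h; omega]
  rw [e1, e2, e3]
  ring

theorem det_tridiag_add_two (n : ℕ) :
    (tridiag (n + 2)).det = 2 * (tridiag (n + 1)).det - (tridiag n).det := by
  have s1 : (tridiag (n + 2)).submatrix Fin.succ Fin.succ = tridiag (n + 1) := by
    ext i j
    simp [tridiag]
  have s2 : ((tridiag (n + 2)).submatrix Fin.succ (Fin.succAbove 1)).det = (tridiag n).det := by
    rw [det_succ_column_zero, Fin.sum_univ_succ, Finset.sum_eq_zero]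
    · have : ((tridiag (n + 2)).submatrix Fin.succ (Fin.succAbove 1)).submatrix
          (Fin.succAbove 0) Fin.succ = tridiag n := by
        ext i j
        simp [tridiag, Fin.succAbove, Fin.lt_def]
      rw [this]
      simp [tridiag]
    · intro i _
      simp [tridiag]
  rw [det_succ_row_zero, Fin.sum_univ_succ, Fin.sum_univ_succ, Finset.sum_eq_zero]
  · simp only [Fin.succ_zero_eq_one, Fin.succAbove_zero, s1, s2]
    simp [tridiag]
    ring
  · intro i _
    simp [tridiag]

theorem det_tridiag (n : ℕ) : (tridiag n).det = n + 1 ∧ (tridiag (n + 1)).det = n + 2 := by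
  induction n with
  | zero => simp [tridiag]
  | succ n ih =>
    refine ⟨by rw [ih.2]; push_cast; ring, ?_⟩
    rw [det_tridiag_add_two, ih.1, ih.2]
    push_cast
    ring

/-- Distances to the position `0` on a cycle of length `2 * k + 1`. -/
def jumpVec (k : ℕ) : Fin (2 * k) → ℚ := fun i => jumpDist k 0 (i + 1)

/-- The distance matrix of a cycle of length `2 * k + 1` reduced by the row and the column of the
position `0`. -/
def jumpMat (k : ℕ) : Matrix (Fin (2 * k)) (Fin (2 * k)) ℚ := fun i j =>
  (jumpDist k (i + 1) (j + 1) : ℚ) - jumpDist k 0 (i + 1) - jumpDist k 0 (j + 1)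

theorem sum_jumpVec (k : ℕ) : ∑ i, jumpVec k i = k * (k + 1) := by
  simp only [jumpVec]
  rw [Fin.sum_univ_eq_sum_range (fun i => (jumpDist k 0 (i + 1) : ℚ)) (2 * k)]
  exact_mod_cast sum_jumpDist le_rfl

theorem jumpDist_add_add_rat {k i j : ℕ} (hi : i < 2 * k) (hj : j ≤ 2 * k) :
    (jumpDist k i j : ℚ) + 2 * jumpDist k (i + 1) j + jumpDist k (i + 2) j =
      2 * k + 1 - (if i + 1 = j then 1 else 0) := by
  rw [eq_sub_iff_add_eq]
  exact_mod_cast jumpDist_add_add hi hj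

theorem tridiag_mulVec_jumpVec (k : ℕ) (i : Fin (2 * k)) :
    (tridiag (2 * k) *ᵥ jumpVec k) i = 2 * k + 1 := by
  have h := sum_tridiag_mul (n := 2 * k) (fun t => (jumpDist k 0 t : ℚ))
    (by simp [jumpDist_zero_zero])
    (by simp [jumpDist_comm k 0, jumpDist_end, jumpDist_zero_zero]) i
  have h' := jumpDist_add_add_rat i.2 (Nat.zero_le _)
  simp only [jumpDist_comm k _ 0] at h'
  rw [mulVec, dotProduct]
  simp only [jumpVec]
  rw [h, h']
  simp

theorem tridiag_mul_jumpMat (k : ℕ) :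
    tridiag (2 * k) * jumpMat k =
      -(1 + replicateCol Unit (fun _ => (4 : ℚ)) * replicateRow Unit (jumpVec k)) := by
  ext i j
  have h := sum_tridiag_mul (n := 2 * k)
    (fun t => (jumpDist k t (j + 1) : ℚ) - jumpDist k 0 t - jumpDist k 0 (j + 1))
    (by simp [jumpDist_zero_zero])
    (by
      rw [jumpDist_end (by omega), jumpDist_comm k 0 (2 * k + 1), jumpDist_end (by omega)]
      simp [jumpDist_zero_zero]) i
  have h1 := jumpDist_add_add_rat i.2 (Nat.zero_le _)
  have h2 := jumpDist_add_add_rat i.2 (show (j : ℕ) + 1 ≤ 2 * k by omega)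
  simp only [jumpDist_comm k _ 0] at h1
  rw [mul_apply]
  simp only [jumpMat]
  rw [h, Matrix.neg_apply, Matrix.add_apply, mul_apply, one_apply]
  simp only [replicateCol_apply, replicateRow_apply, Finset.univ_unique, Finset.sum_singleton,
    jumpVec, Nat.add_right_cancel_iff, Fin.val_inj, Nat.succ_ne_zero, if_false] at h1 h2 ⊢
  linear_combination h2 - h1

theorem det_jumpMat (k : ℕ) : (jumpMat k).det = 2 * k + 1 := by
  have h := congrArg det (tridiag_mul_jumpMat k)
  rw [det_mul, (det_tridiag _).1, det_neg, det_one_add_replicateCol_mul_replicateRow,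
    Fintype.card_fin, pow_mul, neg_one_sq, one_pow, one_mul, dotProduct, ← Finset.sum_mul,
    sum_jumpVec] at h
  have h0 : (2 * k + 1 : ℚ) ≠ 0 := by positivity
  push_cast at h
  apply mul_left_cancel₀ h0
  rw [h]
  ring

theorem jumpMat_mulVec_one (k : ℕ) :
    jumpMat k *ᵥ (fun _ => 1) = -(2 * k + 1 : ℚ) • jumpVec k := by
  have hdet : IsUnit (tridiag (2 * k)).det := by
    rw [(det_tridiag _).1]
    exact (by positivity : ((2 * k : ℕ) : ℚ) + 1 ≠ 0).isUnit
  apply mulVec_injective_of_isUnit ((isUnit_iff_isUnit_det _).2 hdet)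
  ext i
  simp only [mulVec_mulVec, mulVec_smul, tridiag_mul_jumpMat, Pi.smul_apply,
    tridiag_mulVec_jumpVec, neg_mulVec, add_mulVec, one_mulVec, Pi.neg_apply, Pi.add_apply,
    smul_eq_mul]
  simp only [mulVec, dotProduct, mul_apply, replicateCol_apply, replicateRow_apply,
    Finset.univ_unique, Finset.sum_singleton, mul_one, ← Finset.mul_sum,
    sum_jumpVec]
  ring

/-- The vertex of `∞(p,1,q)` with `p = 2 * k + 1`, `q = 2 * l + 1` labelled by the center, or by a
number of jumps on one of the two cycles. -/
def jumpVertex (k l : ℕ) :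
    Unit ⊕ (Fin (2 * k) ⊕ Fin (2 * l)) → Fin (2 * k + 1 + (2 * l + 1) - 1 + 0)
  | .inl _ => ⟨0, by omega⟩
  | .inr (.inl i) => ⟨jumpPos k (i + 1), by have := jumpPos_lt k (i + 1); omega⟩
  | .inr (.inr j) => ⟨2 * k + jumpPos l (j + 1), by have := jumpPos_lt l (j + 1); omega⟩

/-- Number of jumps on the first cycle. -/
def fstJump (k l : ℕ) : Unit ⊕ (Fin (2 * k) ⊕ Fin (2 * l)) → ℕ
  | .inr (.inl i) => i + 1
  | _ => 0

/-- Number of jumps on the second cycle. -/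
def sndJump (k l : ℕ) : Unit ⊕ (Fin (2 * k) ⊕ Fin (2 * l)) → ℕ
  | .inr (.inr j) => j + 1
  | _ => 0

theorem fstJump_le (k l : ℕ) (x) : fstJump k l x ≤ 2 * k := by
  rcases x with _ | i | j <;> simp only [fstJump] <;> omega

theorem sndJump_le (k l : ℕ) (x) : sndJump k l x ≤ 2 * l := by
  rcases x with _ | i | j <;> simp only [sndJump] <;> omega

theorem fstPos_jumpVertex (k l : ℕ) (x) :
    fstPos (2 * k + 1) (jumpVertex k l x) = jumpPos k (fstJump k l x) := by
  rcases x with _ | i | j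
  · simp [fstPos, jumpVertex, fstJump, jumpPos]
  · exact if_pos (jumpPos_lt _ _)
  · have := jumpPos_pos j.2
    have h0 : jumpPos k 0 = 0 := by simp [jumpPos]
    simp only [fstJump, h0]
    exact if_neg (by simp only [jumpVertex]; omega)

theorem sndPos_jumpVertex (k l : ℕ) (x) :
    sndPos (2 * k + 1) (jumpVertex k l x) = jumpPos l (sndJump k l x) := by
  rcases x with _ | i | j
  · simp [sndPos, jumpVertex, sndJump, jumpPos]
  · have := jumpPos_lt k (i + 1)
    have h0 : jumpPos l 0 = 0 := by simp [jumpPos]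
    simp only [sndPos, jumpVertex, sndJump, h0]
    omega
  · simp [sndPos, jumpVertex, sndJump]

theorem jumpVertex_bijective (k l : ℕ) : Function.Bijective (jumpVertex k l) := by
  rw [Fintype.bijective_iff_injective_and_card]
  refine ⟨fun x y h => ?_, ?_⟩
  · have h1 : fstJump k l x = fstJump k l y :=
      jumpPos_inj (fstJump_le k l x) (fstJump_le k l y)
        (by rw [← fstPos_jumpVertex, ← fstPos_jumpVertex, h])
    have h2 : sndJump k l x = sndJump k l y :=
      jumpPos_inj (sndJump_le k l x) (sndJump_le k l y)
        (by rw [← sndPos_jumpVertex, ← sndPos_jumpVertex, h])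
    rcases x with _ | i | j <;> rcases y with _ | i' | j' <;>
      simp_all [fstJump, sndJump, Fin.ext_iff]
  · simp only [Fintype.card_sum, Fintype.card_unit, Fintype.card_fin]
    omega

theorem distMatrix_Gpq_jumpVertex {k l : ℕ} (hk : 1 ≤ k) (hl : 1 ≤ l) (x y) :
    distMatrix (Gpq (2 * k + 1) (2 * l + 1) 0) (jumpVertex k l x) (jumpVertex k l y) =
      jumpDist k (fstJump k l x) (fstJump k l y) + jumpDist l (sndJump k l x) (sndJump k l y) := by
  rw [distMatrix, dist_Gpq_zero (by omega) (by omega)]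
  simp only [fstPos_jumpVertex, sndPos_jumpVertex, cycleDist_jumpPos (fstJump_le k l _)
    (fstJump_le k l _), cycleDist_jumpPos (sndJump_le k l _) (sndJump_le k l _)]
  push_cast
  rfl

/-- Subtracting the row and the column of an index from all others does not change the
determinant. -/
theorem det_eq_det_fromBlocks_sub {R n : Type*} [CommRing R] [Fintype n] [DecidableEq n]
    (A : Matrix (Unit ⊕ n) (Unit ⊕ n) R) (h0 : A (.inl ()) (.inl ()) = 0) :
    A.det = (fromBlocks 0 (replicateRow Unit fun j => A (.inl ()) (.inr j))
      (replicateCol Unit fun i => A (.inr i) (.inl ()))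
      (of fun i j => A (.inr i) (.inr j) - A (.inr i) (.inl ()) - A (.inl ()) (.inr j))).det := by
  set c : Unit ⊕ n → R := Sum.elim (fun _ => 0) (fun _ => 1)
  trans (of fun i j => A i j - c i * A (.inl ()) j).det
  · refine det_eq_of_forall_row_eq_smul_add_const c (.inl ()) rfl fun i j => ?_
    simp [c]
  · rw [← det_transpose, ← det_transpose (fromBlocks _ _ _ _)]
    refine det_eq_of_forall_row_eq_smul_add_const c (.inl ()) rfl fun i j => ?_
    rcases i with _ | i <;> rcases j with _ | j <;> simp [c, h0]
    ring

theorem det_distMatrix_Gpq_odd {k l : ℕ} (hk : 1 ≤ k) (hl : 1 ≤ l) :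
    (distMatrix (Gpq (2 * k + 1) (2 * l + 1) 0)).det =
      (2 * l + 1) * (k * (k + 1)) + (2 * k + 1) * (l * (l + 1)) := by
  rw [← det_submatrix_equiv_self (Equiv.ofBijective _ (jumpVertex_bijective k l)),
    det_eq_det_fromBlocks_sub _ (by
      simp [distMatrix_Gpq_jumpVertex hk hl, fstJump, sndJump, jumpDist_zero_zero])]
  have hD : (fromBlocks (jumpMat k) 0 0 (jumpMat l)).det = (2 * k + 1 : ℚ) * (2 * l + 1) := by
    rw [det_fromBlocks_zero₂₁, det_jumpMat, det_jumpMat]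
  have hk0 : (2 * k + 1 : ℚ) ≠ 0 := by positivity
  have hl0 : (2 * l + 1 : ℚ) ≠ 0 := by positivity
  set a : Fin (2 * k) ⊕ Fin (2 * l) → ℚ := Sum.elim (jumpVec k) (jumpVec l) with ha
  set x : Fin (2 * k) ⊕ Fin (2 * l) → ℚ :=
    Sum.elim (fun _ => -(2 * k + 1 : ℚ)⁻¹) (fun _ => -(2 * l + 1 : ℚ)⁻¹) with hx
  have hblocks : ∀ {A B C D}, A = (0 : Matrix Unit Unit ℚ) → B = replicateRow Unit a →
      C = replicateCol Unit a → D = fromBlocks (jumpMat k) 0 0 (jumpMat l) →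
      (fromBlocks A B C D).det =
        (2 * l + 1) * (k * (k + 1)) + (2 * k + 1) * (l * (l + 1)) := by
    rintro A B C D rfl rfl rfl hD'
    rw [← hD'] at hD
    have hunit : IsUnit D.det := by
      rw [hD]
      exact (mul_ne_zero hk0 hl0).isUnit
    let _ := invertibleOfIsUnitDet D hunit
    have hDx : D * replicateCol Unit x = replicateCol Unit a := by
      have e : ∀ m : ℕ, (2 * m + 1 : ℚ) ≠ 0 →
          jumpMat m *ᵥ (fun _ => -(2 * m + 1 : ℚ)⁻¹) = jumpVec m := by
        intro m hm
        rw [show (fun _ : Fin (2 * m) => -(2 * m + 1 : ℚ)⁻¹) =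
          (-(2 * m + 1 : ℚ)⁻¹) • (fun _ => 1) by ext; simp, mulVec_smul, jumpMat_mulVec_one,
          smul_smul, neg_mul_neg, inv_mul_cancel₀ hm, one_smul]
      rw [← replicateCol_mulVec, hD', hx, fromBlocks_mulVec]
      simp [Sum.elim_comp_inl, Sum.elim_comp_inr, e k hk0, e l hl0, ha]
    rw [det_fromBlocks₂₂, hD, Matrix.mul_assoc, ← hDx, ← Matrix.mul_assoc (⅟D),
      invOf_mul_self, Matrix.one_mul, det_unique,
      Matrix.sub_apply, replicateRow_mul_replicateCol_apply, dotProduct, Fintype.sum_sum_type]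
    simp only [ha, hx, Sum.elim_inl, Sum.elim_inr, ← Finset.sum_mul, sum_jumpVec, Matrix.zero_apply]
    field_simp
    ring
  refine hblocks rfl ?_ ?_ ?_
  · ext _ (j | j) <;>
      simp [distMatrix_Gpq_jumpVertex hk hl, fstJump, sndJump, jumpDist_zero_zero, ha, jumpVec]
  · ext (j | j) _ <;>
      simp [distMatrix_Gpq_jumpVertex hk hl, fstJump, sndJump, jumpDist_zero_zero, ha, jumpVec,
        jumpDist_comm _ _ 0]
  · ext (i | i) (j | j) <;>
      simp [distMatrix_Gpq_jumpVertex hk hl, fstJump, sndJump, jumpDist_zero_zero, jumpMat,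
        jumpDist_comm _ _ 0]

/-- If `p, q ≥ 3` are odd, then the determinant of the distance matrix of
`G(p,q;0) = ∞(p,1,q)` equals `(pq-1)(p+q)/4`. -/
theorem det_distMatrix_Gpq_zero_ext (p q : ℕ) (hp : 3 ≤ p) (hq : 3 ≤ q)
    (hpodd : Odd p) (hqodd : Odd q) :
    (distMatrix (Gpq p q 0)).det = ((p : ℚ) * q - 1) * ((p : ℚ) + q) / 4 := by
  obtain ⟨k, rfl⟩ := hpodd
  obtain ⟨l, rfl⟩ := hqodd
  rw [det_distMatrix_Gpq_odd (by omega) (by omega)]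
  push_cast
  ring
end

section
/- Let p, q ≥ 3 be odd integers. Then the determinant of the distance matrix of G(p,q;1) equals −(1/2)(p+q)(pq−1) − pq. -/
open SimpleGraph Matrix

/-- The distance between the vertices `a` and `b` of the cycle of length `2 * k + 1`. -/
def oddCycleDist (k a b : ℕ) : ℕ :=
  if a ≤ b then min (b - a) (2 * k + 1 - (b - a)) else min (a - b) (2 * k + 1 - (a - b))

/-- The determinant of a matrix is unchanged under taking successive differences in both
directions. -/
theorem det_eq_det_second_difference (n : ℕ) (F : ℕ → ℕ → ℚ) (h₀ : ∀ j, F 0 j = 0)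
    (h₁ : ∀ i, F i 0 = 0) :
    (Matrix.of fun i j : Fin n => F (i + 1) (j + 1)).det =
      (Matrix.of fun i j : Fin n =>
        F (i + 1) (j + 1) - F i (j + 1) - F (i + 1) j + F i j).det := by
  cases n with
  | zero => simp
  | succ n =>
    trans (Matrix.of fun i j : Fin (n + 1) => F (i + 1) (j + 1) - F i (j + 1)).det
    · refine Matrix.det_eq_of_forall_row_eq_smul_add_pred (fun _ => 1) ?_ ?_
      · intro j; simp [h₀]
      · intro i j; simp
    · refine Matrix.det_eq_of_forall_col_eq_smul_add_pred (fun _ => 1) ?_ ?_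
      · intro i; simp [h₁]
      · intro i j; simp

/-- The determinant of the discrete Laplacian with Dirichlet boundary conditions. -/
theorem det_tridiagonal (n : ℕ) :
    (Matrix.of fun i j : Fin n =>
      if (i : ℕ) = j then (-2 : ℚ) else if (i : ℕ) + 1 = j ∨ (j : ℕ) + 1 = i then 1 else 0).det =
      (-1) ^ n * (n + 1) := by
  cases n with
  | zero => simp
  | succ n =>
    trans (Matrix.of fun i j : Fin (n + 1) =>
      if (i : ℕ) = j then -((i : ℚ) + 2) / (i + 1) else if (i : ℕ) + 1 = j then 1 else 0).det
    · symm
      refine Matrix.det_eq_of_forall_row_eq_smul_add_pred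
        (fun i => ((i : ℚ) + 1) / (i + 2)) ?_ ?_
      · intro j
        simp
      · intro i j
        have h1 : ((i : ℕ) : ℚ) + 1 ≠ 0 := by positivity
        have h2 : ((i : ℕ) : ℚ) + 2 ≠ 0 := by positivity
        have h3 : ((i : ℕ) : ℚ) + 1 + 1 ≠ 0 := by positivity
        simp only [Matrix.of_apply, Fin.val_succ, Fin.val_castSucc]
        split_ifs <;> first | omega | skip
        all_goals push_cast; field_simp
        all_goals ring
    · rw [Matrix.det_of_isUpperTriangular]
      · simp only [Matrix.of_apply, if_true]
        rw [Fin.prod_univ_eq_prod_range (fun i : ℕ => -((i : ℚ) + 2) / (i + 1))]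
        induction n + 1 with
        | zero => simp
        | succ m ih =>
          rw [Finset.prod_range_succ, ih]
          have : (m : ℚ) + 1 ≠ 0 := by positivity
          field_simp
          push_cast
          ring
      · intro i j hij
        have : (j : ℕ) < i := hij
        simp only [Matrix.of_apply]
        rw [if_neg (by omega), if_neg (by omega)]

/-- The form `d(i,j) - d(i,0) - d(0,j)` on the cycle of length `2 * k + 1`. -/
def oddCycleForm (k i j : ℕ) : ℚ :=
  oddCycleDist k i j - oddCycleDist k 0 i - oddCycleDist k 0 j

theorem oddCycleForm_second_difference (k i j : ℕ) (hi : i < 2 * k) (hj : j < 2 * k) :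
    oddCycleForm k (i + 1) (j + 1) - oddCycleForm k i (j + 1) - oddCycleForm k (i + 1) j +
      oddCycleForm k i j =
      ((if i = j then -2 else if i + k = j ∨ j + k = i ∨ i + k + 1 = j ∨ j + k + 1 = i
        then 1 else 0 : ℤ) : ℚ) := by
  have h : ((oddCycleDist k (i + 1) (j + 1) : ℤ) - oddCycleDist k i (j + 1)
      - oddCycleDist k (i + 1) j + oddCycleDist k i j) =
      (if i = j then -2 else if i + k = j ∨ j + k = i ∨ i + k + 1 = j ∨ j + k + 1 = i
        then 1 else 0 : ℤ) := by
    unfold oddCycleDist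
    split_ifs <;> omega
  rw [← h]
  unfold oddCycleForm
  push_cast
  ring

theorem det_oddCycleForm (k : ℕ) :
    (Matrix.of fun i j : Fin (2 * k) => oddCycleForm k (i + 1) (j + 1)).det = 2 * k + 1 := by
  rw [det_eq_det_second_difference]
  · let f : Fin (2 * k) → Fin (2 * k) := fun i =>
      ⟨if (i : ℕ) + 1 ≤ k then 2 * k - 2 * i - 2 else 4 * k - 2 * i - 1, by
        split_ifs <;> omega⟩
    have hf : Function.Injective f := by
      intro i j h
      simp only [f, Fin.mk.injEq] at h
      ext
      split_ifs at h <;> omega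
    let e := Equiv.ofBijective f (Finite.injective_iff_bijective.mp hf)
    have key := det_tridiagonal (2 * k)
    rw [← Matrix.det_submatrix_equiv_self e] at key
    simp only [even_two, Even.mul_right, Even.neg_pow, one_pow, one_mul] at key
    push_cast at key
    rw [← key]
    congr 1
    ext i j
    simp only [Matrix.of_apply, Matrix.submatrix_apply, e, Equiv.ofBijective_apply]
    rw [oddCycleForm_second_difference k i j i.2 j.2]
    have : (if (i : ℕ) = j then -2 else if (i : ℕ) + k = j ∨ (j : ℕ) + k = i ∨
        (i : ℕ) + k + 1 = j ∨ (j : ℕ) + k + 1 = i then 1 else 0 : ℤ) =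
        if (f i : ℕ) = f j then -2 else
          if (f i : ℕ) + 1 = f j ∨ (f j : ℕ) + 1 = f i then 1 else 0 := by
      simp only [f]
      split_ifs <;> omega
    rw [this]
    push_cast
    rfl
  · intro j; simp [oddCycleForm, oddCycleDist]
  · intro i
    unfold oddCycleForm oddCycleDist
    rcases i with _ | i <;> simp

theorem sum_oddCycleDist_zero (k : ℕ) :
    ∑ j ∈ Finset.range (2 * k + 1), oddCycleDist k 0 j = k * (k + 1) := by
  have h1 : ∀ m ≤ k + 1, 2 * ∑ j ∈ Finset.range m, (oddCycleDist k 0 j : ℤ) = m * (m - 1) := by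
    intro m
    induction m with
    | zero => simp
    | succ m ih =>
      intro hm
      have : oddCycleDist k 0 m = m := by unfold oddCycleDist; simp; omega
      rw [Finset.sum_range_succ, mul_add, ih (by omega), this]
      push_cast; ring
  have h2 : ∀ t ≤ k, 2 * ∑ j ∈ Finset.range (k + 1 + t), (oddCycleDist k 0 j : ℤ) =
      k * (k + 1) + t * (2 * k - t + 1) := by
    intro t
    induction t with
    | zero => intro _; rw [h1 _ (by omega)]; push_cast; ring
    | succ t ih =>
      intro ht
      have : (oddCycleDist k 0 (k + 1 + t) : ℤ) = k - t := by unfold oddCycleDist; simp; omega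
      rw [← add_assoc, Finset.sum_range_succ, mul_add, ih (by omega), this]
      push_cast; ring
  have h3 := h2 k le_rfl
  rw [show k + 1 + k = 2 * k + 1 by ring] at h3
  zify
  linarith

theorem sum_oddCycleDist (k i : ℕ) (hi : i ≤ 2 * k) :
    ∑ j ∈ Finset.range (2 * k + 1), oddCycleDist k i j = k * (k + 1) := by
  induction i with
  | zero => exact sum_oddCycleDist_zero k
  | succ i ih =>
    rw [← ih (by omega), Finset.sum_range_succ', Finset.sum_range_succ]
    congr 1
    · refine Finset.sum_congr rfl fun j _ => ?_
      unfold oddCycleDist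
      split_ifs <;> omega
    · unfold oddCycleDist
      split_ifs <;> omega

theorem sum_fin_oddCycleDist_zero (k : ℕ) :
    ∑ j : Fin (2 * k), (oddCycleDist k 0 (j + 1) : ℚ) = k * (k + 1) := by
  have h := sum_oddCycleDist_zero k
  rw [Finset.sum_range_succ', show oddCycleDist k 0 0 = 0 by simp [oddCycleDist], add_zero] at h
  rw [Fin.sum_univ_eq_sum_range (fun j => (oddCycleDist k 0 (j + 1) : ℚ))]
  exact_mod_cast h

theorem sum_oddCycleForm (k : ℕ) (i : Fin (2 * k)) :
    ∑ j : Fin (2 * k), oddCycleForm k (i + 1) (j + 1) =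
      -(2 * k + 1) * oddCycleDist k 0 (i + 1) := by
  have h := sum_oddCycleDist k (i + 1) (by omega)
  rw [Finset.sum_range_succ', show oddCycleDist k (i + 1) 0 = oddCycleDist k 0 (i + 1) by
    simp [oddCycleDist]] at h
  have h' : ∑ j : Fin (2 * k), (oddCycleDist k (i + 1) (j + 1) : ℚ) +
      oddCycleDist k 0 (i + 1) = k * (k + 1) := by
    rw [Fin.sum_univ_eq_sum_range (fun j => (oddCycleDist k (i + 1) (j + 1) : ℚ))]
    exact_mod_cast h
  simp only [oddCycleForm, Finset.sum_sub_distrib, sum_fin_oddCycleDist_zero, Finset.sum_const,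
    Finset.card_univ, Fintype.card_fin, nsmul_eq_mul]
  push_cast
  linarith

/-- The determinant of a bordered matrix, as it arises from a distance matrix by singling out one
vertex. -/
theorem det_bordered {ι : Type*} [Fintype ι] [DecidableEq ι] (A : Matrix ι ι ℚ) (x y : ι → ℚ)
    (h : A.mulVec y = -x) :
    (Matrix.fromBlocks (0 : Matrix Unit Unit ℚ) (Matrix.replicateRow Unit x)
      (Matrix.replicateCol Unit x) (Matrix.of fun i j => A i j + x i + x j)).det =
      (x ⬝ᵥ y) * A.det := by
  have h' : ∀ i, ∑ j, A i j * y j = -x i := fun i => congrFun h i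
  have hM : Matrix.fromBlocks (1 : Matrix Unit Unit ℚ) 0 (Matrix.replicateCol Unit (-1)) 1 *
      Matrix.fromBlocks (0 : Matrix Unit Unit ℚ) (Matrix.replicateRow Unit x)
      (Matrix.replicateCol Unit x) (Matrix.of fun i j => A i j + x i + x j) *
      Matrix.fromBlocks (1 : Matrix Unit Unit ℚ) (Matrix.replicateRow Unit (-1)) 0 1 *
      Matrix.fromBlocks (1 : Matrix Unit Unit ℚ) 0 (Matrix.replicateCol Unit y) 1 =
      Matrix.fromBlocks (Matrix.of fun _ _ => x ⬝ᵥ y) (Matrix.replicateRow Unit x) 0 A := by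
    simp only [Matrix.fromBlocks_multiply, Matrix.mul_one, Matrix.one_mul, Matrix.mul_zero,
      Matrix.zero_mul, add_zero, zero_add]
    congr 1
    · ext i j
      simp [Matrix.mul_apply, h']
    · ext i j
      simp only [Matrix.mul_apply, Matrix.add_apply, Matrix.replicateCol_apply,
        Matrix.replicateRow_apply, Matrix.of_apply, Pi.neg_apply, Pi.one_apply,
        Finset.univ_unique, Finset.sum_singleton]
      ring
  have := congrArg Matrix.det hM
  simpa [Matrix.det_mul] using this

/-- A function which changes by at most one along edges and can always be decreased along an edge
is the graph distance. -/
theorem SimpleGraph.dist_eq_of_forall_adj {V : Type*} (G : SimpleGraph V) (d : V → V → ℕ)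
    (h₀ : ∀ a, d a a = 0) (h₁ : ∀ a b c, G.Adj a b → d a c ≤ d b c + 1)
    (h₂ : ∀ a c, a ≠ c → ∃ b, G.Adj a b ∧ d b c + 1 ≤ d a c) (a c : V) :
    G.dist a c = d a c := by
  have lower : ∀ {a c : V} (w : G.Walk a c), d a c ≤ w.length := by
    intro a c w
    induction w with
    | nil => simp [h₀]
    | cons hadj w ih =>
      rw [Walk.length_cons]
      exact (h₁ _ _ _ hadj).trans (by omega)
  have upper : ∀ (n : ℕ) (a c : V), d a c ≤ n → ∃ w : G.Walk a c, w.length ≤ d a c := by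
    intro n
    induction n with
    | zero =>
      intro a c h
      by_cases hac : a = c
      · subst hac; exact ⟨.nil, by simp⟩
      · obtain ⟨b, -, hb⟩ := h₂ a c hac
        omega
    | succ n ih =>
      intro a c h
      by_cases hac : a = c
      · subst hac; exact ⟨.nil, by simp⟩
      · obtain ⟨b, hab, hb⟩ := h₂ a c hac
        obtain ⟨w, hw⟩ := ih b c (by omega)
        exact ⟨.cons hab w, by rw [Walk.length_cons]; omega⟩
  obtain ⟨w, hw⟩ := upper _ a c le_rfl
  apply le_antisymm ((dist_le w).trans hw)
  obtain ⟨w', hw'⟩ := (Walk.reachable w).exists_walk_length_eq_dist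
  rw [← hw']
  exact lower w'

/-- One orientation of each edge of the cycle of length `2 * k + 1`. -/
def OddCycleArc (k a b : ℕ) : Prop :=
  (a + 1 = b ∧ b ≤ 2 * k) ∨ (a = 0 ∧ b = 2 * k)

theorem oddCycleDist_le_of_arc {k a b c : ℕ} (hk : 1 ≤ k) (hab : OddCycleArc k a b)
    (hc : c ≤ 2 * k) :
    oddCycleDist k a c ≤ oddCycleDist k b c + 1 ∧
      oddCycleDist k b c ≤ oddCycleDist k a c + 1 := by
  unfold oddCycleDist
  rcases hab with h | h <;> split_ifs <;> omega

theorem exists_arc_oddCycleDist_lt {k a c : ℕ} (ha : a ≤ 2 * k) (hc : c ≤ 2 * k) (hac : a ≠ c) :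
    ∃ b ≤ 2 * k, (OddCycleArc k a b ∨ OddCycleArc k b a) ∧
      oddCycleDist k b c + 1 ≤ oddCycleDist k a c := by
  unfold OddCycleArc oddCycleDist
  rcases lt_or_gt_of_ne hac with h | h
  · by_cases h' : c - a ≤ k
    · exact ⟨a + 1, by omega, by omega, by split_ifs <;> omega⟩
    · by_cases h0 : a = 0
      · exact ⟨2 * k, by omega, by omega, by split_ifs <;> omega⟩
      · exact ⟨a - 1, by omega, by omega, by split_ifs <;> omega⟩
  · by_cases h' : a - c ≤ k
    · exact ⟨a - 1, by omega, by omega, by split_ifs <;> omega⟩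
    · by_cases h0 : a = 2 * k
      · exact ⟨0, by omega, by omega, by split_ifs <;> omega⟩
      · exact ⟨a + 1, by omega, by omega, by split_ifs <;> omega⟩

/-- The retraction of `G(2k+1, 2l+1; 1)` onto its first cycle. -/
def firstProj (k a : ℕ) : ℕ := if a ≤ 2 * k then a else 0

/-- The retraction of `G(2k+1, 2l+1; 1)` onto its second cycle, whose vertices are numbered
`0, …, 2l`. -/
def secondProj (k l a : ℕ) : ℕ := if 2 * k < a ∧ a ≤ 2 * k + 2 * l then a - 2 * k else 0

/-- The retraction of `G(2k+1, 2l+1; 1)` onto its pendant edge. -/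
def pendantProj (k l a : ℕ) : ℕ := if 2 * k + 2 * l < a then 1 else 0

/-- The distance between the vertices `a` and `b` of `G(2k+1, 2l+1; 1)`. -/
def bicyclicDist (k l a b : ℕ) : ℕ :=
  oddCycleDist k (firstProj k a) (firstProj k b) +
    oddCycleDist l (secondProj k l a) (secondProj k l b) +
    ((pendantProj k l a - pendantProj k l b) + (pendantProj k l b - pendantProj k l a))

/-- One orientation of each edge of `G(2k+1, 2l+1; 1)`. -/
def BicyclicArc (k l a b : ℕ) : Prop :=
  OddCycleArc k a b ∨ (a = 0 ∧ b = 2 * k + 1) ∨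
    (2 * k < a ∧ a + 1 = b ∧ b ≤ 2 * k + 2 * l) ∨ (a = 0 ∧ b = 2 * k + 2 * l) ∨
    (a = 0 ∧ b = 2 * k + 2 * l + 1)

theorem firstProj_le (k a : ℕ) : firstProj k a ≤ 2 * k := by
  unfold firstProj; split_ifs <;> omega

theorem secondProj_le (k l a : ℕ) : secondProj k l a ≤ 2 * l := by
  unfold secondProj; split_ifs <;> omega

theorem BicyclicArc.proj {k l a b : ℕ} (hl : 1 ≤ l) (hab : BicyclicArc k l a b) :
    (OddCycleArc k (firstProj k a) (firstProj k b) ∧ secondProj k l a = secondProj k l b ∧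
      pendantProj k l a = pendantProj k l b) ∨
    (firstProj k a = firstProj k b ∧ OddCycleArc l (secondProj k l a) (secondProj k l b) ∧
      pendantProj k l a = pendantProj k l b) ∨
    (firstProj k a = firstProj k b ∧ secondProj k l a = secondProj k l b ∧
      pendantProj k l a = 0 ∧ pendantProj k l b = 1) := by
  unfold firstProj secondProj pendantProj
  unfold BicyclicArc at hab
  rcases hab with h | h
  · left
    unfold OddCycleArc at *
    split_ifs <;> omega
  · unfold OddCycleArc
    rcases h with h | h | h | h <;> split_ifs <;> omega

theorem bicyclicDist_le_of_arc {k l a b : ℕ} (hk : 1 ≤ k) (hl : 1 ≤ l)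
    (hab : BicyclicArc k l a b) (c : ℕ) :
    bicyclicDist k l a c ≤ bicyclicDist k l b c + 1 ∧
      bicyclicDist k l b c ≤ bicyclicDist k l a c + 1 := by
  unfold bicyclicDist
  rcases hab.proj hl with ⟨h, h₁, h₂⟩ | ⟨h₁, h, h₂⟩ | ⟨h₁, h₂, h, h'⟩
  · have := oddCycleDist_le_of_arc hk h (firstProj_le k c)
    rw [h₁, h₂]
    omega
  · have := oddCycleDist_le_of_arc hl h (secondProj_le k l c)
    rw [h₁, h₂]
    omega
  · rw [h₁, h₂]
    omega

theorem firstProj_of_le {k a : ℕ} (h : a ≤ 2 * k) : firstProj k a = a := if_pos h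

theorem firstProj_of_lt {k a : ℕ} (h : 2 * k < a) : firstProj k a = 0 := if_neg (by omega)

theorem secondProj_of_le {k l a : ℕ} (h : a ≤ 2 * k) : secondProj k l a = 0 := if_neg (by omega)

theorem secondProj_add {k l a : ℕ} (h : a ≤ 2 * l) : secondProj k l (2 * k + a) = a := by
  unfold secondProj; split_ifs <;> omega

theorem secondProj_of_lt {k l a : ℕ} (h : 2 * k + 2 * l < a) : secondProj k l a = 0 :=
  if_neg (by omega)

theorem pendantProj_of_le {k l a : ℕ} (h : a ≤ 2 * k + 2 * l) : pendantProj k l a = 0 :=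
  if_neg (by omega)

theorem pendantProj_of_lt {k l a : ℕ} (h : 2 * k + 2 * l < a) : pendantProj k l a = 1 :=
  if_pos h

/-- The inclusion of the second cycle into `G(2k+1, 2l+1; 1)`. -/
def secondIncl (k b : ℕ) : ℕ := if b = 0 then 0 else 2 * k + b

theorem secondIncl_le (k : ℕ) {l b : ℕ} (h : b ≤ 2 * l) : secondIncl k b ≤ 2 * k + 2 * l := by
  unfold secondIncl; split_ifs <;> omega

theorem secondProj_secondIncl {k l b : ℕ} (h : b ≤ 2 * l) :
    secondProj k l (secondIncl k b) = b := by
  unfold secondIncl secondProj; split_ifs <;> omega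

theorem firstProj_secondIncl (k b : ℕ) : firstProj k (secondIncl k b) = 0 := by
  unfold secondIncl firstProj; split_ifs <;> omega

theorem OddCycleArc.secondIncl {k l a b : ℕ} (hl : 1 ≤ l) (h : OddCycleArc l a b) :
    BicyclicArc k l (secondIncl k a) (secondIncl k b) := by
  unfold BicyclicArc _root_.secondIncl
  rcases h with h | h
  · right; split_ifs <;> omega
  · right; split_ifs <;> omega

theorem exists_arc_bicyclicDist_lt {k l a c : ℕ} (ha : a ≤ 2 * k + 2 * l + 1)
    (hc : c ≤ 2 * k + 2 * l + 1) (hac : a ≠ c) :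
    ∃ b ≤ 2 * k + 2 * l + 1, (BicyclicArc k l a b ∨ BicyclicArc k l b a) ∧
      bicyclicDist k l b c + 1 ≤ bicyclicDist k l a c := by
  unfold bicyclicDist
  by_cases h₁ : a ≤ 2 * k ∧ firstProj k a ≠ firstProj k c
  · obtain ⟨b, hb, hab, hd⟩ := exists_arc_oddCycleDist_lt (firstProj_le k a) (firstProj_le k c) h₁.2
    rw [firstProj_of_le h₁.1] at hab hd ⊢
    refine ⟨b, by omega, hab.imp .inl .inl, ?_⟩
    rw [firstProj_of_le hb, secondProj_of_le hb, secondProj_of_le h₁.1,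
      pendantProj_of_le (by omega : b ≤ _), pendantProj_of_le (by omega : a ≤ _)]
    omega
  by_cases h₂ : (a = 0 ∨ 2 * k < a) ∧ a ≤ 2 * k + 2 * l ∧ secondProj k l a ≠ secondProj k l c
  · obtain ⟨b, hb, hab, hd⟩ :=
      exists_arc_oddCycleDist_lt (secondProj_le k l a) (secondProj_le k l c) h₂.2.2
    have hl : 1 ≤ l := by
      have := secondProj_le k l a
      have := secondProj_le k l c
      omega
    have ha' : a = secondIncl k (secondProj k l a) := by
      unfold secondIncl secondProj; split_ifs <;> omega
    have hfa : firstProj k a = 0 := by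
      unfold firstProj; split_ifs <;> omega
    have hb' := secondIncl_le k hb
    refine ⟨secondIncl k b, by omega, ?_, ?_⟩
    · rw [ha']
      exact hab.imp (·.secondIncl hl) (·.secondIncl hl)
    · rw [secondProj_secondIncl hb, hfa, firstProj_secondIncl, pendantProj_of_le hb',
        pendantProj_of_le h₂.2.1]
      omega
  by_cases h₃ : a = 2 * k + 2 * l + 1
  · refine ⟨0, by omega, .inr (by unfold BicyclicArc; omega), ?_⟩
    rw [firstProj_of_le (Nat.zero_le _), firstProj_of_lt (by omega : _ < a),
      secondProj_of_le (Nat.zero_le _), secondProj_of_lt (by omega : _ < a), pendantProj_of_le (Nat.zero_le _),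
      pendantProj_of_lt (by omega : _ < a), pendantProj_of_le (by omega : c ≤ _)]
  · obtain ⟨rfl, rfl⟩ : a = 0 ∧ c = 2 * k + 2 * l + 1 := by
      unfold firstProj at h₁
      unfold secondProj at h₂
      split_ifs at * <;> omega
    refine ⟨_, le_rfl, .inl (by unfold BicyclicArc; omega), ?_⟩
    rw [firstProj_of_le (Nat.zero_le _), firstProj_of_lt (by omega : 2 * k < _),
      secondProj_of_le (Nat.zero_le _), secondProj_of_lt (by omega : _ < 2 * k + 2 * l + 1),
      pendantProj_of_le (Nat.zero_le _), pendantProj_of_lt (by omega : _ < 2 * k + 2 * l + 1)]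

theorem Gpq_one_adj_iff {k l : ℕ} (hl : 1 ≤ l)
    (a b : Fin (2 * k + 1 + (2 * l + 1) - 1 + 1)) :
    (Gpq (2 * k + 1) (2 * l + 1) 1).Adj a b ↔
      a ≠ b ∧ (BicyclicArc k l a b ∨ BicyclicArc k l b a) := by
  have h : ∀ a b : Fin (2 * k + 1 + (2 * l + 1) - 1 + 1), BicyclicArc k l a b ↔
      (((a : ℕ) + 1 = (b : ℕ) ∧ (b : ℕ) < 2 * k + 1) ∨
      ((a : ℕ) = 0 ∧ (b : ℕ) = 2 * k + 1 - 1) ∨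
      ((a : ℕ) = 0 ∧ (b : ℕ) = 2 * k + 1) ∨
      (2 * k + 1 ≤ (a : ℕ) ∧ (a : ℕ) + 1 = (b : ℕ) ∧ (b : ℕ) ≤ 2 * k + 1 + (2 * l + 1) - 2) ∨
      ((a : ℕ) = 0 ∧ (b : ℕ) = 2 * k + 1 + (2 * l + 1) - 2) ∨
      (1 ≤ 1 ∧ (a : ℕ) = 0 ∧ (b : ℕ) = 2 * k + 1 + (2 * l + 1) - 1) ∨
      (2 * k + 1 + (2 * l + 1) - 1 ≤ (a : ℕ) ∧ (a : ℕ) + 1 = (b : ℕ))) := by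
    intro a b
    unfold BicyclicArc OddCycleArc
    omega
  rw [h, h, Gpq, SimpleGraph.fromRel_adj]

theorem Gpq_one_dist {k l : ℕ} (hk : 1 ≤ k) (hl : 1 ≤ l)
    (a b : Fin (2 * k + 1 + (2 * l + 1) - 1 + 1)) :
    (Gpq (2 * k + 1) (2 * l + 1) 1).dist a b = bicyclicDist k l a b := by
  refine SimpleGraph.dist_eq_of_forall_adj _ (fun a b : Fin _ => bicyclicDist k l a b) ?_ ?_ ?_ a b
  · intro a
    simp [bicyclicDist, oddCycleDist]
  · intro a b c hab
    rcases ((Gpq_one_adj_iff hl a b).mp hab).2 with h | h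
    · exact (bicyclicDist_le_of_arc hk hl h c).1
    · exact (bicyclicDist_le_of_arc hk hl h c).2
  · intro a c hac
    obtain ⟨b, hb, hab, hd⟩ := exists_arc_bicyclicDist_lt (k := k) (l := l)
      (by omega : (a : ℕ) ≤ _) (by omega : (c : ℕ) ≤ _) (by omega)
    refine ⟨⟨b, by omega⟩, (Gpq_one_adj_iff hl _ _).mpr ⟨?_, hab⟩, hd⟩
    intro h
    simp [h] at hd

/-- The vertices of `G(2k+1, 2l+1; 1)`: the center vertex, the other vertices of the two cycles, and
the pendant vertex. -/
def bicyclicVertex (k l : ℕ) :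
    Unit ⊕ ((Fin (2 * k) ⊕ Fin (2 * l)) ⊕ Unit) → Fin (2 * k + 1 + (2 * l + 1) - 1 + 1)
  | .inl _ => ⟨0, by omega⟩
  | .inr (.inl (.inl i)) => ⟨i + 1, by omega⟩
  | .inr (.inl (.inr j)) => ⟨2 * k + (j + 1), by omega⟩
  | .inr (.inr _) => ⟨2 * k + 2 * l + 1, by omega⟩

theorem bicyclicVertex_bijective (k l : ℕ) : Function.Bijective (bicyclicVertex k l) := by
  rw [Fintype.bijective_iff_injective_and_card]
  constructor
  · rintro (_ | (i | i) | _) (_ | (j | j) | _) h <;>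
      simp only [bicyclicVertex, Fin.mk.injEq] at h <;>
      first
        | rfl
        | (exfalso; omega)
        | (obtain rfl : i = j := by omega
           rfl)
  · simp
    omega

theorem oddCycleDist_comm (k a b : ℕ) : oddCycleDist k a b = oddCycleDist k b a := by
  unfold oddCycleDist
  split_ifs <;> omega

theorem oddCycleDist_self (k a : ℕ) : oddCycleDist k a a = 0 := by simp [oddCycleDist]

theorem distMatrix_submatrix_bicyclicVertex {k l : ℕ} (hk : 1 ≤ k) (hl : 1 ≤ l)
    (A : Matrix ((Fin (2 * k) ⊕ Fin (2 * l)) ⊕ Unit) ((Fin (2 * k) ⊕ Fin (2 * l)) ⊕ Unit) ℚ)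
    (hA : A = Matrix.fromBlocks (Matrix.fromBlocks
      (Matrix.of fun i j : Fin (2 * k) => oddCycleForm k (i + 1) (j + 1)) 0 0
      (Matrix.of fun i j : Fin (2 * l) => oddCycleForm l (i + 1) (j + 1))) 0 0
      (Matrix.of fun _ _ => -2))
    (x : (Fin (2 * k) ⊕ Fin (2 * l)) ⊕ Unit → ℚ)
    (hx : x = Sum.elim (Sum.elim (fun i : Fin (2 * k) => (oddCycleDist k 0 (i + 1) : ℚ))
      (fun j : Fin (2 * l) => (oddCycleDist l 0 (j + 1) : ℚ))) 1) :
    (distMatrix (Gpq (2 * k + 1) (2 * l + 1) 1)).submatrix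
        (bicyclicVertex k l) (bicyclicVertex k l) =
      Matrix.fromBlocks (0 : Matrix Unit Unit ℚ) (Matrix.replicateRow Unit x)
      (Matrix.replicateCol Unit x) (Matrix.of fun i j => A i j + x i + x j) := by
  have f₀ : firstProj k 0 = 0 := firstProj_of_le (Nat.zero_le _)
  have s₀ : secondProj k l 0 = 0 := secondProj_of_le (Nat.zero_le _)
  have p₀ : pendantProj k l 0 = 0 := pendantProj_of_le (Nat.zero_le _)
  have f₁ : ∀ i : Fin (2 * k), firstProj k (i + 1) = i + 1 := fun i => firstProj_of_le (by omega)
  have s₁ : ∀ i : Fin (2 * k), secondProj k l (i + 1) = 0 := fun i => secondProj_of_le (by omega)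
  have p₁ : ∀ i : Fin (2 * k), pendantProj k l (i + 1) = 0 :=
    fun i => pendantProj_of_le (by omega)
  have f₂ : ∀ i : Fin (2 * l), firstProj k (2 * k + (i + 1)) = 0 :=
    fun i => firstProj_of_lt (by omega)
  have s₂ : ∀ i : Fin (2 * l), secondProj k l (2 * k + (i + 1)) = i + 1 :=
    fun i => secondProj_add (by omega)
  have p₂ : ∀ i : Fin (2 * l), pendantProj k l (2 * k + (i + 1)) = 0 :=
    fun i => pendantProj_of_le (by omega)
  have f₃ : firstProj k (2 * k + 2 * l + 1) = 0 := firstProj_of_lt (by omega)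
  have s₃ : secondProj k l (2 * k + 2 * l + 1) = 0 := secondProj_of_lt (by omega)
  have p₃ : pendantProj k l (2 * k + 2 * l + 1) = 1 := pendantProj_of_lt (by omega)
  subst hA hx
  ext (_ | (i | i) | _) (_ | (j | j) | _) <;>
    simp only [Matrix.submatrix_apply, distMatrix, Gpq_one_dist hk hl, bicyclicDist,
      bicyclicVertex, f₀, s₀, p₀, f₁, s₁, p₁, f₂, s₂, p₂, f₃, s₃, p₃, oddCycleDist_self,
      Matrix.fromBlocks_apply₁₁, Matrix.fromBlocks_apply₁₂, Matrix.fromBlocks_apply₂₁,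
      Matrix.fromBlocks_apply₂₂, Matrix.replicateRow_apply, Matrix.replicateCol_apply,
      Matrix.of_apply, Matrix.zero_apply, Sum.elim_inl, Sum.elim_inr, Pi.one_apply,
      oddCycleForm, oddCycleDist_comm _ _ 0] <;>
    push_cast <;> ring

/-- If `p, q ≥ 3` are odd, then the determinant of the distance matrix of
`G(p,q;1)` equals `-(1/2)(p+q)(pq-1) - pq`. -/
theorem det_distMatrix_Gpq_one_ext (p q : ℕ) (hp : 3 ≤ p) (hq : 3 ≤ q)
    (hpodd : Odd p) (hqodd : Odd q) :
    (distMatrix (Gpq p q 1)).det =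
      -(1 / 2 : ℚ) * ((p : ℚ) + q) * ((p : ℚ) * q - 1) - (p : ℚ) * q := by
  obtain ⟨k, rfl⟩ := hpodd
  obtain ⟨l, rfl⟩ := hqodd
  have hk : (2 * k + 1 : ℚ) ≠ 0 := by positivity
  have hl : (2 * l + 1 : ℚ) ≠ 0 := by positivity
  rw [← Matrix.det_submatrix_equiv_self (Equiv.ofBijective _ (bicyclicVertex_bijective k l))]
  simp only [Equiv.coe_ofBijective]
  rw [distMatrix_submatrix_bicyclicVertex (by omega) (by omega) _ rfl _ rfl,
    det_bordered _ _ (Sum.elim (Sum.elim (fun _ => 1 / (2 * k + 1 : ℚ))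
      (fun _ => 1 / (2 * l + 1 : ℚ))) (fun _ => 1 / 2))]
  · simp only [Matrix.det_fromBlocks_zero₂₁, det_oddCycleForm, Matrix.det_unique,
      Matrix.of_apply, dotProduct, Fintype.sum_sum_type, Sum.elim_inl, Sum.elim_inr,
      ← Finset.sum_mul, sum_fin_oddCycleDist_zero, Pi.one_apply, Finset.univ_unique,
      Finset.sum_singleton]
    push_cast
    field_simp
    ring
  · ext ((i | i) | _) <;>
      simp only [Matrix.mulVec, dotProduct, Fintype.sum_sum_type, Sum.elim_inl, Sum.elim_inr,
        Matrix.fromBlocks_apply₁₁, Matrix.fromBlocks_apply₁₂, Matrix.fromBlocks_apply₂₁,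
        Matrix.fromBlocks_apply₂₂, Matrix.of_apply, Matrix.zero_apply, zero_mul,
        Finset.sum_const_zero, add_zero, zero_add, ← Finset.sum_mul, sum_oddCycleForm,
        Pi.neg_apply, Pi.one_apply, Finset.univ_unique, Finset.sum_singleton]
    · field_simp
    · field_simp
    · norm_num
end

section
/- For every integer k ≥ 1, det C_k = (−1)^k(2k+1)/2^k. -/
open Matrix

/-- The `k × k` rational matrix `B_k`, with `-1` on the diagonal and on the first
subdiagonal, and `0` elsewhere. -/
def Bmat (k : ℕ) : Matrix (Fin k) (Fin k) ℚ :=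
  Matrix.of fun i j => if (i : ℕ) = (j : ℕ) then -1
    else if (j : ℕ) + 1 = (i : ℕ) then -1 else 0

/-- The `k × k` rational matrix `C_k = (1/2) B_k B_kᵀ - 2 I_k`. -/
def Cmat (k : ℕ) : Matrix (Fin k) (Fin k) ℚ :=
  (1 / 2 : ℚ) • (Bmat k * (Bmat k)ᵀ) - (2 : ℚ) • (1 : Matrix (Fin k) (Fin k) ℚ)

/-- The lower bidiagonal matrix with diagonal `d` and subdiagonal `e`. -/
def lowerBidiagonal (k : ℕ) (d e : ℕ → ℚ) : Matrix (Fin k) (Fin k) ℚ :=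
  Matrix.of fun i j => if (i : ℕ) = (j : ℕ) then d i
    else if (j : ℕ) + 1 = (i : ℕ) then e i else 0

lemma sum_range_bidiagonal_mul (k i : ℕ) (hi : i < k) (a b : ℚ) (f : ℕ → ℚ) :
    ∑ m ∈ Finset.range k, (if i = m then a else if m + 1 = i then b else 0) * f m =
      a * f i + if i = 0 then 0 else b * f (i - 1) := by
  have h_split : ∀ m, (if i = m then a else if m + 1 = i then b else 0) * f m =
      (if i = m then a * f m else 0) + (if m + 1 = i then b * f m else 0) := by
    intro m
    split_ifs <;> first | omega | ring
  simp only [h_split, Finset.sum_add_distrib]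
  rw [Finset.sum_ite_eq, if_pos (Finset.mem_range.2 hi)]
  congr 1
  cases i with
  | zero => simp
  | succ n =>
    have hn : n < k := by omega
    simp [hn]

lemma lowerBidiagonal_mul_transpose_apply (k : ℕ) (d e d' e' : ℕ → ℚ) (i j : Fin k) :
    (lowerBidiagonal k d e * (lowerBidiagonal k d' e')ᵀ) i j =
      d i * (if (j : ℕ) = i then d' j else if (i : ℕ) + 1 = j then e' j else 0) +
      if (i : ℕ) = 0 then 0 else
        e i * (if (j : ℕ) = i - 1 then d' j else if (i : ℕ) - 1 + 1 = j then e' j else 0) := by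
  rw [← sum_range_bidiagonal_mul k i i.2 (d i) (e i)
    (fun m => if (j : ℕ) = m then d' j else if m + 1 = j then e' j else 0),
    ← Fin.sum_univ_eq_sum_range (fun m : ℕ =>
      (if (i : ℕ) = m then d i else if m + 1 = i then e i else 0) *
        (if (j : ℕ) = m then d' j else if m + 1 = j then e' j else 0))]
  rfl

lemma det_lowerBidiagonal (k : ℕ) (d e : ℕ → ℚ) :
    (lowerBidiagonal k d e).det = ∏ i ∈ Finset.range k, d i := by
  rw [Matrix.det_of_isLowerTriangular, ← Fin.prod_univ_eq_prod_range]
  · simp [lowerBidiagonal]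
  · intro i j hij
    have hlt : (i : ℕ) < j := hij
    simp only [lowerBidiagonal, Matrix.of_apply]
    rw [if_neg (by omega), if_neg (by omega)]

/-- An `LU` decomposition of `C_k`. -/
lemma Cmat_eq_mul (k : ℕ) :
    Cmat k = lowerBidiagonal k (fun _ => 1) (fun i => -((2 * i - 1) / (2 * i + 1))) *
      (lowerBidiagonal k (fun i => -((2 * i + 3) / (2 * (2 * i + 1)))) (fun _ => 1 / 2))ᵀ := by
  have hB : Bmat k = lowerBidiagonal k (fun _ => -1) (fun _ => -1) := rfl
  ext i j
  rw [Cmat, hB, Matrix.sub_apply, Matrix.smul_apply, Matrix.smul_apply,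
    lowerBidiagonal_mul_transpose_apply, lowerBidiagonal_mul_transpose_apply, Matrix.one_apply]
  simp only [Fin.ext_iff, smul_eq_mul]
  obtain ⟨i, hi⟩ := i
  obtain ⟨j, hj⟩ := j
  dsimp only
  cases i with
  | zero =>
    split_ifs <;> first | omega | (subst_vars; norm_num)
  | succ n =>
    have hdiag : (-1 : ℚ) = -((2 * ((n : ℚ) + 1) + 3) / (2 * (2 * (n + 1) + 1))) +
        -((2 * ((n : ℚ) + 1) - 1) / (2 * (n + 1) + 1) * (1 / 2)) := by
      field_simp
      ring
    split_ifs <;> first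
      | omega
      | contradiction
      | (subst_vars; push_cast; norm_num; done)
      | (subst_vars; simp only [Nat.add_sub_cancel]; push_cast; field_simp; ring1)
      | (subst_vars; push_cast; norm_num; exact hdiag)

lemma prod_range_pivots (k : ℕ) :
    ∏ i ∈ Finset.range k, (-((2 * (i : ℚ) + 3) / (2 * (2 * i + 1)))) =
      (-1 : ℚ) ^ k * (2 * (k : ℚ) + 1) / 2 ^ k := by
  induction k with
  | zero => simp
  | succ n ih =>
    rw [Finset.prod_range_succ, ih]
    push_cast
    field_simp
    ring

/-- For every `k ≥ 1`, `det C_k = (-1)^k (2k+1) / 2^k`. -/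
theorem det_Cmat (k : ℕ) (hk : 1 ≤ k) :
    (Cmat k).det = (-1 : ℚ) ^ k * (2 * (k : ℚ) + 1) / 2 ^ k := by
  rw [Cmat_eq_mul, Matrix.det_mul, Matrix.det_transpose, det_lowerBidiagonal,
    det_lowerBidiagonal, prod_range_pivots, Finset.prod_const_one, one_mul]
end

section
/- For every integer k ≥ 1, the matrix C_k is invertible and F_k · C_k⁻¹ · F_kᵀ = −k/(2(2k+1)), where the left-hand side is the 1×1 quantity obtained by multiplying the row vector F_k, the inverse matrix C_k⁻¹, and the column vector F_kᵀ. -/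
open Matrix

/-- The rational row vector `F_k = (1/2)·𝟏·B_kᵀ + 𝟏`, regarded as a `1 × k` matrix. -/
def Fvec (k : ℕ) : Matrix (Fin 1) (Fin k) ℚ :=
  (1 / 2 : ℚ) • ((Matrix.of fun _ _ => (1 : ℚ) : Matrix (Fin 1) (Fin k) ℚ) * (Bmat k)ᵀ)
    + Matrix.of fun _ _ => 1

/-- Left multiplication by `B_k`, on a column given by a function on `ℕ`. -/
lemma sum_Bmat_mul {k : ℕ} (i : Fin k) (y : ℕ → ℚ) :
    ∑ j : Fin k, Bmat k i j * y j = -y i - if (i : ℕ) = 0 then 0 else y (i - 1) := by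
  obtain ⟨i, hi⟩ := i
  let g : ℕ → ℚ := fun j => (if i = j then -y j else 0) + if j + 1 = i then -y j else 0
  have h : ∀ j : Fin k, Bmat k ⟨i, hi⟩ j * y j = g j := by
    intro j
    simp only [g, Bmat, of_apply]
    split_ifs <;> first | omega | ring
  rw [Finset.sum_congr rfl fun j _ => h j, Fin.sum_univ_eq_sum_range g, Finset.sum_add_distrib,
    Finset.sum_ite_eq, if_pos (Finset.mem_range.2 hi)]
  rcases i with _ | i
  · simp
  · simp [(Nat.lt_succ_self i).trans hi]
    ring

/-- Left multiplication by `B_kᵀ`, on a column given by a function on `ℕ` vanishing at `k`. -/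
lemma sum_Bmat_transpose_mul {k : ℕ} (i : Fin k) (y : ℕ → ℚ) (hy : y k = 0) :
    ∑ j : Fin k, (Bmat k)ᵀ i j * y j = -(y i + y (i + 1)) := by
  obtain ⟨i, hi⟩ := i
  let g : ℕ → ℚ := fun j => (if i = j then -y j else 0) + if i + 1 = j then -y j else 0
  have h : ∀ j : Fin k, (Bmat k)ᵀ ⟨i, hi⟩ j * y j = g j := by
    intro j
    simp only [g, Bmat, transpose_apply, of_apply]
    split_ifs <;> first | omega | ring
  rw [Finset.sum_congr rfl fun j _ => h j, Fin.sum_univ_eq_sum_range g, Finset.sum_add_distrib,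
    Finset.sum_ite_eq, Finset.sum_ite_eq, if_pos (Finset.mem_range.2 hi)]
  dsimp only
  split_ifs with h1
  · ring
  · have : i + 1 = k := by rw [Finset.mem_range] at h1; omega
    rw [this, hy]
    ring

/-- The inverse of `C_k`: the Green's function of the tridiagonal matrix `-2 C_k`, scaled. -/
def CmatInv (k : ℕ) : Matrix (Fin k) (Fin k) ℚ :=
  Matrix.of fun i j =>
    -2 * ((1 + 2 * (min (i : ℕ) j : ℕ)) * (k - (max (i : ℕ) j : ℕ))) / (2 * k + 1)

lemma Cmat_mul_CmatInv (k : ℕ) : Cmat k * CmatInv k = 1 := by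
  ext i j
  let y : ℕ → ℚ := fun i =>
    -2 * ((1 + 2 * (min i j : ℕ)) * (k - (max i j : ℕ))) / (2 * k + 1)
  have hy : y k = 0 := by simp [y]
  have hB : (Bmat k * ((Bmat k)ᵀ * CmatInv k)) i j =
      (y i + y (i + 1)) + if (i : ℕ) = 0 then 0 else y (i - 1) + y (i - 1 + 1) := by
    have h : ∀ l : Fin k, ((Bmat k)ᵀ * CmatInv k) l j = -(y l + y (l + 1)) := fun l =>
      (mul_apply ..).trans (sum_Bmat_transpose_mul l y hy)
    simp only [mul_apply (M := Bmat k), h]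
    rw [sum_Bmat_mul i fun l => -(y l + y (l + 1))]
    split_ifs <;> ring
  have hk : (2 * k + 1 : ℚ) ≠ 0 := by positivity
  rw [Cmat, sub_mul, smul_mul, smul_mul, one_mul, mul_assoc, Matrix.sub_apply, Matrix.smul_apply,
    Matrix.smul_apply, hB, show CmatInv k i j = y i from rfl, one_apply]
  obtain ⟨i, hi⟩ := i
  obtain ⟨j, hj⟩ := j
  simp only [y, smul_eq_mul, Fin.mk.injEq]
  rcases i with _ | i
  · rcases j with _ | j
    · simp
      field_simp
      ring
    · simp
      field_simp
      ring
  · rw [if_neg i.succ_ne_zero, Nat.add_sub_cancel]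
    rcases lt_trichotomy (i + 1) j with h | h | h
    · rw [if_neg h.ne, min_eq_left (by omega), min_eq_left (by omega), min_eq_left (by omega),
        max_eq_right (by omega), max_eq_right (by omega), max_eq_right (by omega)]
      push_cast
      field_simp
      ring
    · subst h
      rw [if_pos rfl, min_self, max_self, min_eq_right (by omega), min_eq_left (by omega),
        max_eq_left (by omega), max_eq_right (by omega)]
      push_cast
      field_simp
      ring
    · rw [if_neg h.ne', min_eq_right (by omega), min_eq_right (by omega), min_eq_right (by omega),
        max_eq_left (by omega), max_eq_left (by omega), max_eq_left (by omega)]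
      push_cast
      field_simp
      ring

lemma Fvec_apply {k : ℕ} (a : Fin 1) (i : Fin k) :
    Fvec k a i = if (i : ℕ) = 0 then 1 / 2 else 0 := by
  have h := sum_Bmat_mul i fun _ => 1
  simp only [mul_one] at h
  simp only [Fvec, Matrix.add_apply, Matrix.smul_apply, mul_apply, of_apply, transpose_apply,
    one_mul, h, smul_eq_mul]
  split_ifs <;> norm_num

/-- For every `k ≥ 1`, the matrix `C_k` is invertible and
`F_k C_k⁻¹ F_kᵀ = -k / (2(2k+1))`. -/
theorem Fvec_Cmat_inv_Fvec (k : ℕ) (hk : 1 ≤ k) :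
    IsUnit (Cmat k) ∧
      (Fvec k * (Cmat k)⁻¹ * (Fvec k)ᵀ) 0 0 =
        -(k : ℚ) / (2 * (2 * (k : ℚ) + 1)) := by
  have hC := Cmat_mul_CmatInv k
  refine ⟨IsUnit.of_mul_eq_one _ hC, ?_⟩
  rw [inv_eq_right_inv hC]
  obtain ⟨n, rfl⟩ : ∃ n, k = n + 1 := ⟨k - 1, by omega⟩
  simp only [mul_apply, transpose_apply, Fvec_apply, Fin.sum_univ_succ]
  simp [CmatInv]
  field_simp
  ring
end

section
/- Let G₁ be a connected finite simple graph and let u and v be two (not necessarily distinct) vertices of G₁. For a vertex w of G₁, let G₁ᵂ denote the graph obtained from G₁ by adding one new vertex adjacent only to w (a pendant vertex attached at w). Then the determinant of the distance matrix of G₁ᵘ equals the determinant of the distance matrix of G₁ᵛ; that is, the determinant of the distance matrix of the graph obtained by attaching a single pendant vertex to G₁ does not depend on the vertex of attachment. -/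
open SimpleGraph Matrix

/-- The graph obtained from `G` by adding one new pendant vertex (`none`)
adjacent exactly to the vertex `w`. -/
def addPendant {V : Type*} (G : SimpleGraph V) (w : V) : SimpleGraph (Option V) :=
  SimpleGraph.fromRel (fun a b =>
    (∃ x y, a = some x ∧ b = some y ∧ G.Adj x y) ∨ (a = none ∧ b = some w))

namespace addPendant

variable {V : Type*} {G : SimpleGraph V} {w : V}

lemma adj_some_some {x y : V} : (addPendant G w).Adj (some x) (some y) ↔ G.Adj x y := by
  simp only [addPendant, SimpleGraph.fromRel_adj]
  constructor
  · rintro ⟨-, (⟨a, b, ha, hb, h⟩ | ⟨h, -⟩) | (⟨a, b, ha, hb, h⟩ | ⟨h, -⟩)⟩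
    · cases ha; cases hb; exact h
    · cases h
    · cases ha; cases hb; exact h.symm
    · cases h
  · intro h
    exact ⟨fun e => h.ne (Option.some.inj e), Or.inl (Or.inl ⟨x, y, rfl, rfl, h⟩)⟩

lemma adj_none_some {y : V} : (addPendant G w).Adj none (some y) ↔ y = w := by
  simp [addPendant, SimpleGraph.fromRel_adj]

/-- The inclusion of a graph into the graph with a pendant vertex added. -/
def someHom (G : SimpleGraph V) (w : V) : G →g addPendant G w where
  toFun := some
  map_rel' h := adj_some_some.2 h

lemma dist_getD_le_length (hG : G.Connected) {a b : Option V} (p : (addPendant G w).Walk a b) :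
    G.dist (a.getD w) (b.getD w) ≤ p.length := by
  induction p with
  | nil => simp
  | @cons a c b h q ih =>
    have hac : G.dist (a.getD w) (c.getD w) ≤ 1 := by
      cases a with
      | none =>
        cases c with
        | none => simp
        | some y => simp [adj_none_some.1 h]
      | some x =>
        cases c with
        | none => simp [adj_none_some.1 h.symm]
        | some y => exact (SimpleGraph.dist_eq_one_iff_adj.2 (adj_some_some.1 h)).le
    have := hG.dist_triangle (u := a.getD w) (v := c.getD w) (w := b.getD w)
    rw [SimpleGraph.Walk.length_cons]
    omega

lemma dist_some_some (hG : G.Connected) (x y : V) :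
    (addPendant G w).dist (some x) (some y) = G.dist x y := by
  obtain ⟨p, hp⟩ := hG.exists_walk_length_eq_dist x y
  let q : (addPendant G w).Walk (some x) (some y) := p.map (someHom G w)
  have hq : q.length = p.length := SimpleGraph.Walk.length_map _ _
  apply le_antisymm
  · rw [← hp, ← hq]
    exact SimpleGraph.dist_le q
  · obtain ⟨r, hr⟩ := q.reachable.exists_walk_length_eq_dist
    rw [← hr]
    exact dist_getD_le_length hG r

lemma dist_none_some (hG : G.Connected) (x : V) :
    (addPendant G w).dist none (some x) = G.dist w x + 1 := by
  obtain ⟨p, hp⟩ := hG.exists_walk_length_eq_dist w x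
  let q : (addPendant G w).Walk (some w) (some x) := p.map (someHom G w)
  have hq : q.length = p.length := SimpleGraph.Walk.length_map _ _
  let q' : (addPendant G w).Walk none (some x) := .cons (adj_none_some.2 rfl) q
  apply le_antisymm
  · rw [← hp, ← hq]
    exact SimpleGraph.dist_le q'
  · obtain ⟨r, hr⟩ := q'.reachable.exists_walk_length_eq_dist
    rw [← hr]
    cases r with
    | @cons _ c _ h s =>
      cases c with
      | none => exact absurd h (SimpleGraph.irrefl _)
      | some y =>
        obtain rfl := adj_none_some.1 h
        exact Nat.succ_le_succ (dist_getD_le_length hG s)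

end addPendant

/-- The matrix `D` bordered by a row and a column of ones, with corner entry `-2`. -/
def borderedMatrix {V : Type*} (D : Matrix V V ℚ) : Matrix (Option V) (Option V) ℚ
  | none, none => -2
  | none, some _ => 1
  | some _, none => 1
  | some x, some y => D x y

/-- Subtracting the row and the column of the attachment vertex from those of the pendant vertex
leaves a matrix which does not involve the attachment vertex. -/
lemma det_distMatrix_addPendant {V : Type*} [Fintype V] [DecidableEq V]
    {G : SimpleGraph V} (hG : G.Connected) (w : V) :
    (distMatrix (addPendant G w)).det = (borderedMatrix (distMatrix G)).det := by
  have hne : (none : Option V) ≠ some w := by simp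
  rw [← Matrix.det_updateRow_add_smul_self _ hne (-1),
    ← Matrix.det_updateCol_add_smul_self _ hne (-1)]
  congr 1
  ext (_ | x) (_ | y)
  · simp [borderedMatrix, distMatrix, addPendant.dist_none_some hG,
      SimpleGraph.dist_comm (u := some w) (v := none)]
    norm_num
  · simp [borderedMatrix, distMatrix, addPendant.dist_none_some hG,
      addPendant.dist_some_some hG]
  · simp [borderedMatrix, distMatrix, addPendant.dist_none_some hG,
      SimpleGraph.dist_comm (u := some x) (v := none), addPendant.dist_some_some hG,
      SimpleGraph.dist_comm (u := x) (v := w)]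
  · simp [borderedMatrix, distMatrix, addPendant.dist_some_some hG]

/-- The determinant of the distance matrix of the graph obtained from a connected
graph `G₁` by attaching a single pendant vertex does not depend on the vertex of
attachment. -/
theorem det_distMatrix_addPendant_indep {V : Type*} [Fintype V] [DecidableEq V]
    (G₁ : SimpleGraph V) (hG₁ : G₁.Connected) (u v : V) :
    (distMatrix (addPendant G₁ u)).det = (distMatrix (addPendant G₁ v)).det := by
  rw [det_distMatrix_addPendant hG₁, det_distMatrix_addPendant hG₁]
end

section
/- Let G₁ and G₂ be connected finite simple graphs on disjoint vertex sets, let u be a vertex of G₁ and w a vertex of G₂. Let G be the graph obtained from the disjoint union of G₁ and G₂ by adding the edge uw, and let G̃ be the graph obtained from the disjoint union of G₁ and G₂ by identifying u and w into a single vertex and then attaching one new pendant vertex to the identified vertex (so G and G̃ have the same number of vertices). Then the determinant of the distance matrix of G equals the determinant of the distance matrix of G̃. -/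
open SimpleGraph Matrix

/-- The graph obtained from the disjoint union of `G₁` and `G₂` by adding the
edge joining `u : V` and `w : W`. -/
def joinByEdge {V W : Type*} (G₁ : SimpleGraph V) (G₂ : SimpleGraph W)
    (u : V) (w : W) : SimpleGraph (V ⊕ W) :=
  SimpleGraph.fromRel (fun a b =>
    (∃ x y, a = Sum.inl x ∧ b = Sum.inl y ∧ G₁.Adj x y) ∨
    (∃ x y, a = Sum.inr x ∧ b = Sum.inr y ∧ G₂.Adj x y) ∨
    (a = Sum.inl u ∧ b = Sum.inr w))

/-- The graph obtained from the disjoint union of `G₁` and `G₂` by identifying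
`u : V` with `w : W` (the identified vertex is represented by `Sum.inl u`; all
edges of `G₂` at `w` are transferred to it) and then attaching one new pendant
vertex (represented by `Sum.inr w`) to the identified vertex. -/
def identifyAndPendant {V W : Type*} (G₁ : SimpleGraph V) (G₂ : SimpleGraph W)
    (u : V) (w : W) : SimpleGraph (V ⊕ W) :=
  SimpleGraph.fromRel (fun a b =>
    (∃ x y, a = Sum.inl x ∧ b = Sum.inl y ∧ G₁.Adj x y) ∨
    (∃ x y, a = Sum.inr x ∧ b = Sum.inr y ∧ x ≠ w ∧ y ≠ w ∧ G₂.Adj x y) ∨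
    (∃ y, a = Sum.inl u ∧ b = Sum.inr y ∧ y ≠ w ∧ G₂.Adj w y) ∨
    (a = Sum.inl u ∧ b = Sum.inr w))

namespace SimpleGraph

/-- A function that changes by at most one along edges, and decreases along some edge away from
its zero, is the distance function. -/
theorem dist_eq_of_step {α : Type*} (G : SimpleGraph α) (F : α → α → ℕ)
    (hself : ∀ a, F a a = 0) (hadj : ∀ a b c, G.Adj a b → F a c ≤ F b c + 1)
    (hstep : ∀ a c, a ≠ c → ∃ b, G.Adj a b ∧ F b c + 1 ≤ F a c) (a c : α) :
    G.dist a c = F a c := by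
  have lower : ∀ {a c : α} (p : G.Walk a c), F a c ≤ p.length := by
    intro a c p
    induction p with
    | nil => simp [hself]
    | cons h p ih => simpa using (hadj _ _ _ h).trans (Nat.succ_le_succ ih)
  have upper : ∀ n a, F a c ≤ n → ∃ p : G.Walk a c, p.length ≤ n := by
    intro n
    induction n with
    | zero =>
      intro a ha
      by_cases hac : a = c
      · subst hac
        exact ⟨Walk.nil, by simp⟩
      · obtain ⟨b, -, hb⟩ := hstep a c hac
        omega
    | succ n ih =>
      intro a ha
      by_cases hac : a = c
      · subst hac
        exact ⟨Walk.nil, by simp⟩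
      · obtain ⟨b, hab, hb⟩ := hstep a c hac
        obtain ⟨p, hp⟩ := ih b (by omega)
        exact ⟨Walk.cons hab p, by simpa using hp⟩
  obtain ⟨p, hp⟩ := upper _ a le_rfl
  obtain ⟨q, hq⟩ := p.reachable.exists_walk_length_eq_dist
  exact le_antisymm ((dist_le p).trans hp) (hq ▸ lower q)

theorem Connected.dist_le_dist_add_one {α : Type*} {G : SimpleGraph α} (hG : G.Connected)
    {a b : α} (h : G.Adj a b) (c : α) : G.dist a c ≤ G.dist b c + 1 := by
  have h₁ := hG.dist_triangle (u := a) (v := b) (w := c)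
  have h₂ := dist_eq_one_iff_adj.mpr h
  omega

theorem Connected.exists_adj_dist_add_one_le {α : Type*} {G : SimpleGraph α} (hG : G.Connected)
    {a c : α} (h : a ≠ c) : ∃ b, G.Adj a b ∧ G.dist b c + 1 ≤ G.dist a c := by
  obtain ⟨p, hp⟩ := hG.exists_walk_length_eq_dist a c
  cases p with
  | nil => exact absurd rfl h
  | cons hab p =>
    refine ⟨_, hab, ?_⟩
    have := dist_le p
    simp only [Walk.length_cons] at hp
    omega

end SimpleGraph

/-- The distance function of `joinByEdge G₁ G₂ u w`. -/
noncomputable def joinDist {V W : Type*} (G₁ : SimpleGraph V) (G₂ : SimpleGraph W)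
    (u : V) (w : W) : V ⊕ W → V ⊕ W → ℕ
  | Sum.inl x, Sum.inl y => G₁.dist x y
  | Sum.inl x, Sum.inr y => G₁.dist x u + 1 + G₂.dist y w
  | Sum.inr x, Sum.inl y => G₂.dist x w + 1 + G₁.dist y u
  | Sum.inr x, Sum.inr y => G₂.dist x y

open Classical in
/-- The distance function of `identifyAndPendant G₁ G₂ u w`. -/
noncomputable def pendantDist {V W : Type*} (G₁ : SimpleGraph V) (G₂ : SimpleGraph W)
    (u : V) (w : W) : V ⊕ W → V ⊕ W → ℕ
  | Sum.inl x, Sum.inl y => G₁.dist x y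
  | Sum.inl x, Sum.inr y => G₁.dist x u + if y = w then 1 else G₂.dist y w
  | Sum.inr x, Sum.inl y => G₁.dist y u + if x = w then 1 else G₂.dist x w
  | Sum.inr x, Sum.inr y =>
      if x = y then 0
      else if x = w then 1 + G₂.dist y w
      else if y = w then 1 + G₂.dist x w
      else G₂.dist x y

theorem dist_joinByEdge {V W : Type*} (G₁ : SimpleGraph V) (G₂ : SimpleGraph W)
    (hG₁ : G₁.Connected) (hG₂ : G₂.Connected) (u : V) (w : W) (a b : V ⊕ W) :
    (joinByEdge G₁ G₂ u w).dist a b = joinDist G₁ G₂ u w a b := by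
  have symm₁ : ∀ x y, G₁.dist x y = G₁.dist y x := fun _ _ => dist_comm
  have symm₂ : ∀ x y, G₂.dist x y = G₂.dist y x := fun _ _ => dist_comm
  have adj_ll : ∀ x y, (joinByEdge G₁ G₂ u w).Adj (Sum.inl x) (Sum.inl y) ↔ G₁.Adj x y := by
    intro x y
    simp [joinByEdge, G₁.adj_comm y x]
    exact fun h => h.ne
  have adj_rr : ∀ x y, (joinByEdge G₁ G₂ u w).Adj (Sum.inr x) (Sum.inr y) ↔ G₂.Adj x y := by
    intro x y
    simp [joinByEdge, G₂.adj_comm y x]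
    exact fun h => h.ne
  have adj_lr : ∀ x y, (joinByEdge G₁ G₂ u w).Adj (Sum.inl x) (Sum.inr y) ↔ x = u ∧ y = w := by
    intro x y
    simp [joinByEdge]
  have adj_rl : ∀ x y, (joinByEdge G₁ G₂ u w).Adj (Sum.inr y) (Sum.inl x) ↔ x = u ∧ y = w :=
    fun x y => (adj_comm _ _ _).trans (adj_lr x y)
  apply dist_eq_of_step
  · rintro (x | x) <;> simp [joinDist]
  · rintro (x | x) (y | y) (z | z) h <;>
      simp only [adj_ll, adj_rr, adj_lr, adj_rl] at h <;> simp only [joinDist]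
    · exact hG₁.dist_le_dist_add_one h z
    · have := hG₁.dist_le_dist_add_one h u
      omega
    · obtain ⟨rfl, rfl⟩ := h
      have := symm₁ x z
      omega
    · obtain ⟨rfl, rfl⟩ := h
      have := symm₂ y z
      simp; omega
    · obtain ⟨rfl, rfl⟩ := h
      have := symm₁ y z
      simp; omega
    · obtain ⟨rfl, rfl⟩ := h
      have := symm₂ x z
      omega
    · have := hG₂.dist_le_dist_add_one h w
      omega
    · exact hG₂.dist_le_dist_add_one h z
  · rintro (x | x) (z | z) h
    · obtain ⟨b, hb, hle⟩ := hG₁.exists_adj_dist_add_one_le (a := x) (c := z) (by simpa using h)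
      exact ⟨Sum.inl b, (adj_ll _ _).mpr hb, hle⟩
    · by_cases hx : x = u
      · refine ⟨Sum.inr w, (adj_lr _ _).mpr ⟨hx, rfl⟩, ?_⟩
        have := symm₂ w z
        simp only [joinDist]; omega
      · obtain ⟨b, hb, hle⟩ := hG₁.exists_adj_dist_add_one_le hx
        refine ⟨Sum.inl b, (adj_ll _ _).mpr hb, ?_⟩
        simp only [joinDist]; omega
    · by_cases hx : x = w
      · refine ⟨Sum.inl u, (adj_rl _ _).mpr ⟨rfl, hx⟩, ?_⟩
        have := symm₁ u z
        simp only [joinDist]; omega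
      · obtain ⟨b, hb, hle⟩ := hG₂.exists_adj_dist_add_one_le hx
        refine ⟨Sum.inr b, (adj_rr _ _).mpr hb, ?_⟩
        simp only [joinDist]; omega
    · obtain ⟨b, hb, hle⟩ := hG₂.exists_adj_dist_add_one_le (a := x) (c := z) (by simpa using h)
      exact ⟨Sum.inr b, (adj_rr _ _).mpr hb, hle⟩

theorem dist_identifyAndPendant {V W : Type*} (G₁ : SimpleGraph V) (G₂ : SimpleGraph W)
    (hG₁ : G₁.Connected) (hG₂ : G₂.Connected) (u : V) (w : W) (a b : V ⊕ W) :
    (identifyAndPendant G₁ G₂ u w).dist a b = pendantDist G₁ G₂ u w a b := by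
  have symm₁ : ∀ x y, G₁.dist x y = G₁.dist y x := fun _ _ => dist_comm
  have symm₂ : ∀ x y, G₂.dist x y = G₂.dist y x := fun _ _ => dist_comm
  have self₁ : ∀ x, G₁.dist x x = 0 := fun _ => dist_self
  have self₂ : ∀ x, G₂.dist x x = 0 := fun _ => dist_self
  have near₁ : ∀ x y z, G₁.Adj x y → G₁.dist x z ≤ G₁.dist y z + 1 :=
    fun _ _ z h => hG₁.dist_le_dist_add_one h z
  have near₂ : ∀ x y z, G₂.Adj x y → G₂.dist x z ≤ G₂.dist y z + 1 :=
    fun _ _ z h => hG₂.dist_le_dist_add_one h z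
  have adj_ll : ∀ x y,
      (identifyAndPendant G₁ G₂ u w).Adj (Sum.inl x) (Sum.inl y) ↔ G₁.Adj x y := by
    intro x y
    simp [identifyAndPendant, G₁.adj_comm y x]
    exact fun h => h.ne
  have adj_rr : ∀ x y, (identifyAndPendant G₁ G₂ u w).Adj (Sum.inr x) (Sum.inr y) ↔
      x ≠ w ∧ y ≠ w ∧ G₂.Adj x y := by
    intro x y
    simp [identifyAndPendant, G₂.adj_comm y x]
    have : G₂.Adj x y → x ≠ y := fun h => h.ne
    tauto
  have adj_lr : ∀ x y, (identifyAndPendant G₁ G₂ u w).Adj (Sum.inl x) (Sum.inr y) ↔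
      x = u ∧ (y = w ∨ G₂.Adj w y) := by
    intro x y
    have : G₂.Adj w y → y ≠ w := fun h => h.ne'
    simp [identifyAndPendant]
    tauto
  have adj_rl : ∀ x y, (identifyAndPendant G₁ G₂ u w).Adj (Sum.inr y) (Sum.inl x) ↔
      x = u ∧ (y = w ∨ G₂.Adj w y) :=
    fun x y => (adj_comm _ _ _).trans (adj_lr x y)
  apply dist_eq_of_step
  · rintro (x | x) <;> simp [pendantDist]
  · rintro (x | x) (y | y) (z | z) h <;>
      simp only [adj_ll, adj_rr, adj_lr, adj_rl] at h <;> simp only [pendantDist]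
    · exact near₁ _ _ z h
    · have := near₁ _ _ u h
      omega
    · grind
    · grind [G₂.adj_comm]
    · grind
    · grind [G₂.adj_comm]
    · grind
    · grind
  · rintro (x | x) (z | z) h
    · obtain ⟨b, hb, hle⟩ := hG₁.exists_adj_dist_add_one_le (a := x) (c := z) (by simpa using h)
      exact ⟨Sum.inl b, (adj_ll _ _).mpr hb, hle⟩
    · by_cases hx : x = u
      · by_cases hz : z = w
        · refine ⟨Sum.inr w, (adj_lr _ _).mpr ⟨hx, Or.inl rfl⟩, ?_⟩
          simp [pendantDist, hz]
        · obtain ⟨b, hb, hle⟩ := hG₂.exists_adj_dist_add_one_le (Ne.symm hz)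
          refine ⟨Sum.inr b, (adj_lr _ _).mpr ⟨hx, Or.inr hb⟩, ?_⟩
          have := hb.ne'
          simp only [pendantDist]
          grind
      · obtain ⟨b, hb, hle⟩ := hG₁.exists_adj_dist_add_one_le hx
        refine ⟨Sum.inl b, (adj_ll _ _).mpr hb, ?_⟩
        simp only [pendantDist]; omega
    · by_cases hx : x = w
      · refine ⟨Sum.inl u, (adj_rl _ _).mpr ⟨rfl, Or.inl hx⟩, ?_⟩
        simp only [pendantDist]
        grind
      · obtain ⟨b, hb, hle⟩ := hG₂.exists_adj_dist_add_one_le hx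
        by_cases hbw : b = w
        · refine ⟨Sum.inl u, (adj_rl _ _).mpr ⟨rfl, Or.inr (hbw ▸ hb.symm)⟩, ?_⟩
          simp only [pendantDist]
          grind
        · refine ⟨Sum.inr b, (adj_rr _ _).mpr ⟨hx, hbw, hb⟩, ?_⟩
          simp only [pendantDist]
          grind
    · have hxz : x ≠ z := by simpa using h
      by_cases hx : x = w
      · refine ⟨Sum.inl u, (adj_rl _ _).mpr ⟨rfl, Or.inl hx⟩, ?_⟩
        simp only [pendantDist]
        grind
      · obtain ⟨b, hb, hle⟩ := hG₂.exists_adj_dist_add_one_le hxz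
        by_cases hz : z = w
        · by_cases hbw : b = w
          · refine ⟨Sum.inl u, (adj_rl _ _).mpr ⟨rfl, Or.inr (hbw ▸ hb.symm)⟩, ?_⟩
            simp only [pendantDist]
            grind
          · refine ⟨Sum.inr b, (adj_rr _ _).mpr ⟨hx, hbw, hb⟩, ?_⟩
            simp only [pendantDist]
            grind
        · by_cases hbw : b = w
          · refine ⟨Sum.inl u, (adj_rl _ _).mpr ⟨rfl, Or.inr (hbw ▸ hb.symm)⟩, ?_⟩
            simp only [pendantDist]
            grind
          · refine ⟨Sum.inr b, (adj_rr _ _).mpr ⟨hx, hbw, hb⟩, ?_⟩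
            simp only [pendantDist]
            grind

/-- Congruence by a unipotent rank-one perturbation of the identity preserves determinants. -/
theorem Matrix.det_eq_of_congr_sub {n R : Type*} [Fintype n] [DecidableEq n] [CommRing R]
    (A B : Matrix n n R) (s t : n) (q : n → R) (hq : q s = q t)
    (h : ∀ i j, B i j = A i j - q i * (A s j - A t j) - (A i s - A i t) * q j
      + q i * q j * (A s s - A s t - A t s + A t t)) :
    A.det = B.det := by
  set p : n → R := Pi.single s 1 - Pi.single t 1 with hp
  have hdet : (1 - vecMulVec p q).det = 1 := by
    rw [sub_eq_add_neg, ← vecMulVec_neg, vecMulVec_eq Unit,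
      det_one_add_replicateCol_mul_replicateRow]
    simp [hp, hq, dotProduct_sub]
  have hB : B = (1 - vecMulVec p q)ᵀ * A * (1 - vecMulVec p q) := by
    have e : (1 - vecMulVec p q)ᵀ * A * (1 - vecMulVec p q) =
        A - vecMulVec q (p ᵥ* A) - vecMulVec (A *ᵥ p) q +
          (p ᵥ* A ⬝ᵥ p) • vecMulVec q q := by
      rw [transpose_sub, transpose_one, transpose_vecMulVec, sub_mul, one_mul, vecMulVec_mul,
        mul_sub, mul_one, sub_mul, mul_vecMulVec, vecMulVec_mul_vecMulVec]
      ext i j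
      simp [vecMulVec_apply]
      ring
    rw [e]
    ext i j
    rw [h]
    simp [hp, vecMulVec_apply, mulVec_sub, sub_vecMul, dotProduct_sub]
    ring
  rw [hB, det_mul, det_mul, det_transpose, hdet, one_mul, mul_one]

/-- Let `G` be obtained from connected graphs `G₁`, `G₂` by joining `u ∈ G₁` and
`w ∈ G₂` with an edge, and let `G̃` be obtained by identifying `u` and `w` and
attaching a pendant vertex to the identified vertex.  Then the distance matrices
of `G` and `G̃` have equal determinants. -/
theorem det_distMatrix_joinByEdge_eq {V W : Type*} [Fintype V] [DecidableEq V]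
    [Fintype W] [DecidableEq W] (G₁ : SimpleGraph V) (G₂ : SimpleGraph W)
    (hG₁ : G₁.Connected) (hG₂ : G₂.Connected) (u : V) (w : W) :
    (distMatrix (joinByEdge G₁ G₂ u w)).det =
      (distMatrix (identifyAndPendant G₁ G₂ u w)).det := by
  apply Matrix.det_eq_of_congr_sub _ _ (Sum.inr w) (Sum.inl u)
    (Sum.elim (fun _ => 0) fun y => if y = w then 0 else 1)
  · simp
  · have symm₁ : ∀ x y, G₁.dist x y = G₁.dist y x := fun _ _ => dist_comm
    have symm₂ : ∀ x y, G₂.dist x y = G₂.dist y x := fun _ _ => dist_comm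
    rintro (x | x) (y | y) <;>
      simp only [distMatrix, dist_joinByEdge G₁ G₂ hG₁ hG₂,
        dist_identifyAndPendant G₁ G₂ hG₁ hG₂, joinDist, pendantDist, Sum.elim_inl, Sum.elim_inr,
        dist_self]
    · simp
    · split_ifs with hy
      · simp [hy]
      · push_cast; ring
    · split_ifs with hx
      · subst hx; simp; ring
      · push_cast; rw [symm₁ u y]; ring
    · rw [symm₂ w y]
      by_cases hx : x = w <;> by_cases hy : y = w <;> by_cases hxy : x = y <;>
        simp [hx, hy, hxy, symm₂ w y] <;> grind
end

section
/- Let s, t ≥ 1, let A be an s×s rational matrix, B a t×t rational matrix, a an s-dimensional rational row vector and b a t-dimensional rational row vector. Let M be the s×t matrix with entries M(i,j) = a(i) + b(j), let J be the s×t all-ones matrix, and let 𝟏 denote an all-ones row vector of the appropriate dimension. Then the determinant of the (s+t+2)×(s+t+2) block matrix [[0, a, b+𝟏, 1], [aᵀ, A, M+J, aᵀ+𝟏ᵀ], [bᵀ+𝟏ᵀ, Mᵀ+Jᵀ, B, bᵀ], [1, a+𝟏, b, 0]] equals the determinant of the block matrix [[0, a, b, 1], [aᵀ, A, M, aᵀ+𝟏ᵀ],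 [bᵀ, Mᵀ, B, bᵀ+𝟏ᵀ], [1, a+𝟏, b+𝟏, 0]]. -/
open Matrix

/-- The all-ones rational matrix. -/
def allOnes (m n : Type*) : Matrix m n ℚ := Matrix.of fun _ _ => 1

/-- Congruence by an involution preserves the determinant. -/
theorem Matrix.det_transpose_mul_mul_of_mul_self_eq_one {n R : Type*} [Fintype n] [DecidableEq n]
    [CommRing R] (P M : Matrix n n R) (hP : P * P = 1) : (Pᵀ * M * P).det = M.det := by
  have h : P.det * P.det = 1 := by rw [← Matrix.det_mul, hP, Matrix.det_one]
  rw [Matrix.det_mul, Matrix.det_mul, Matrix.det_transpose]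
  linear_combination M.det * h

/-- The involution `(p, x, y, q) ↦ (q - ∑ x, x, y, p + ∑ x)`. -/
def swapShift (s t : ℕ) :
    Matrix ((Fin 1 ⊕ Fin s) ⊕ (Fin t ⊕ Fin 1)) ((Fin 1 ⊕ Fin s) ⊕ (Fin t ⊕ Fin 1)) ℚ :=
  Matrix.fromBlocks
    (Matrix.fromBlocks 0 (-allOnes (Fin 1) (Fin s)) 0 1)
    (Matrix.fromBlocks 0 1 0 0)
    (Matrix.fromBlocks 0 0 1 (allOnes (Fin 1) (Fin s)))
    (Matrix.fromBlocks 1 0 0 0)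

theorem swapShift_mul_self (s t : ℕ) : swapShift s t * swapShift s t = 1 := by
  simp [swapShift, Matrix.fromBlocks_multiply, Matrix.fromBlocks_add, Matrix.fromBlocks_one]

/-- Gong–Zhang–Xu, Lemma 2.3 (matrix form): for `a`, `b` row vectors,
`M(i,j) = a(i) + b(j)` and `J` the all-ones matrix,
`det [[0, a, b+𝟏, 1], [aᵀ, A, M+J, aᵀ+𝟏ᵀ], [bᵀ+𝟏ᵀ, Mᵀ+Jᵀ, B, bᵀ], [1, a+𝟏, b, 0]]
 = det [[0, a, b, 1], [aᵀ, A, M, aᵀ+𝟏ᵀ], [bᵀ, Mᵀ, B, bᵀ+𝟏ᵀ], [1, a+𝟏, b+𝟏, 0]]`. -/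
theorem det_block_eq (s t : ℕ) (hs : 1 ≤ s) (ht : 1 ≤ t)
    (A : Matrix (Fin s) (Fin s) ℚ) (B : Matrix (Fin t) (Fin t) ℚ)
    (a : Matrix (Fin 1) (Fin s) ℚ) (b : Matrix (Fin 1) (Fin t) ℚ) :
    (Matrix.fromBlocks
      (Matrix.fromBlocks (0 : Matrix (Fin 1) (Fin 1) ℚ) a aᵀ A)
      (Matrix.fromBlocks (b + allOnes (Fin 1) (Fin t)) (allOnes (Fin 1) (Fin 1))
        ((Matrix.of fun i j => a 0 i + b 0 j) + allOnes (Fin s) (Fin t))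
        (aᵀ + allOnes (Fin s) (Fin 1)))
      (Matrix.fromBlocks (bᵀ + allOnes (Fin t) (Fin 1))
        ((Matrix.of fun i j => a 0 j + b 0 i) + allOnes (Fin t) (Fin s))
        (allOnes (Fin 1) (Fin 1)) (a + allOnes (Fin 1) (Fin s)))
      (Matrix.fromBlocks B bᵀ b (0 : Matrix (Fin 1) (Fin 1) ℚ))).det =
    (Matrix.fromBlocks
      (Matrix.fromBlocks (0 : Matrix (Fin 1) (Fin 1) ℚ) a aᵀ A)
      (Matrix.fromBlocks b (allOnes (Fin 1) (Fin 1))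
        (Matrix.of fun i j => a 0 i + b 0 j) (aᵀ + allOnes (Fin s) (Fin 1)))
      (Matrix.fromBlocks bᵀ (Matrix.of fun i j => a 0 j + b 0 i)
        (allOnes (Fin 1) (Fin 1)) (a + allOnes (Fin 1) (Fin s)))
      (Matrix.fromBlocks B (bᵀ + allOnes (Fin t) (Fin 1))
        (b + allOnes (Fin 1) (Fin t)) (0 : Matrix (Fin 1) (Fin 1) ℚ))).det := by
  rw [← Matrix.det_transpose_mul_mul_of_mul_self_eq_one _ _ (swapShift_mul_self s t)]
  congr 1
  simp only [swapShift, Matrix.fromBlocks_transpose, Matrix.fromBlocks_multiply,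
    Matrix.fromBlocks_add]
  ext ((i | i) | (i | i)) ((j | j) | (j | j)) <;>
    simp [Matrix.mul_apply, allOnes, Subsingleton.elim _ (0 : Fin 1)] <;> ring
end

section
/- Let k, h ≥ 1 be integers. Then the determinant of the (1+2k+2h)×(1+2k+2h) rational block matrix [[0, 𝟏, 𝟏, 𝟏, 𝟏], [𝟏ᵀ, −2I_k, B_k, 0, 0], [𝟏ᵀ, B_kᵀ, −2I_k, 0, 0], [𝟏ᵀ, 0, 0, −2I_h, B_h], [𝟏ᵀ, 0, 0, B_hᵀ, −2I_h]] equals k(k+1)(2h+1) + h(h+1)(2k+1). -/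
open Matrix

/-- The `k × k` matrix with `1` on the first subdiagonal and `0` elsewhere. -/
def subdiagOne (k : ℕ) : Matrix (Fin k) (Fin k) ℚ :=
  Matrix.of fun i j => if (j : ℕ) + 1 = (i : ℕ) then 1 else 0

/-- The symmetric matrix with diagonal blocks `-2 I_k` and off-diagonal blocks `B_k`, `B_kᵀ`. -/
abbrev pathBlock (k : ℕ) : Matrix (Fin k ⊕ Fin k) (Fin k ⊕ Fin k) ℚ :=
  Matrix.fromBlocks ((-2 : ℚ) • (1 : Matrix (Fin k) (Fin k) ℚ)) (Bmat k)
    (Bmat k)ᵀ ((-2 : ℚ) • (1 : Matrix (Fin k) (Fin k) ℚ))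

lemma Bmat_eq_neg (k : ℕ) : Bmat k = -(1 + subdiagOne k) := by
  ext i j
  simp only [Bmat, subdiagOne, of_apply, Matrix.neg_apply, Matrix.add_apply, one_apply, Fin.ext_iff]
  split_ifs <;> first | omega | norm_num

lemma subdiagOne_mulVec (k : ℕ) (f : ℕ → ℚ) (i : Fin k) :
    (subdiagOne k *ᵥ fun j => f j) i = if (i : ℕ) = 0 then 0 else f (i - 1) := by
  obtain ⟨i, hi⟩ := i
  simp only [mulVec, dotProduct, subdiagOne, of_apply, ite_mul, one_mul, zero_mul]
  rw [Fin.sum_univ_eq_sum_range (fun j => if j + 1 = i then f j else 0) k]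
  cases i with
  | zero => simp
  | succ i => simp [show i < k by omega]

lemma subdiagOne_transpose_mulVec (k : ℕ) (f : ℕ → ℚ) (i : Fin k) :
    ((subdiagOne k)ᵀ *ᵥ fun j => f j) i = if (i : ℕ) + 1 < k then f (i + 1) else 0 := by
  simp only [mulVec, dotProduct, subdiagOne, transpose_apply, of_apply, ite_mul, one_mul, zero_mul]
  rw [Fin.sum_univ_eq_sum_range (fun j => if (i : ℕ) + 1 = j then f j else 0) k]
  simp

lemma one_sub_subdiagOne_mul_allOnes (k : ℕ) :
    (1 - subdiagOne k) * allOnes (Fin k) (Fin 1) =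
      Matrix.of fun (i : Fin k) _ => if (i : ℕ) = 0 then 1 else 0 := by
  ext i j
  have h := subdiagOne_mulVec k (fun _ => 1) i
  have h' : (subdiagOne k * allOnes (Fin k) (Fin 1)) i j = if (i : ℕ) = 0 then 0 else 1 := h
  rw [Matrix.sub_mul, Matrix.one_mul, Matrix.sub_apply, h']
  simp only [allOnes, of_apply]
  split_ifs <;> norm_num

lemma subdiagOne_mul_transpose (k : ℕ) :
    subdiagOne k * (subdiagOne k)ᵀ = 1 -
      ((1 - subdiagOne k) * allOnes (Fin k) (Fin 1)) *
        ((1 - subdiagOne k) * allOnes (Fin k) (Fin 1))ᵀ := by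
  rw [one_sub_subdiagOne_mul_allOnes]
  ext i j
  have h := subdiagOne_mulVec k (fun l => if l + 1 = (j : ℕ) then 1 else 0) i
  have h' : (subdiagOne k * (subdiagOne k)ᵀ) i j =
    if (i : ℕ) = 0 then 0 else if (i : ℕ) - 1 + 1 = (j : ℕ) then 1 else 0 := h
  rw [h']
  simp only [Matrix.sub_apply, one_apply, mul_apply, Finset.univ_unique, Finset.sum_singleton,
    transpose_apply, of_apply, Fin.ext_iff]
  split_ifs <;> first | omega | norm_num

lemma det_one_sub_subdiagOne (k : ℕ) : (1 - subdiagOne k).det = 1 := by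
  rw [det_of_isLowerTriangular]
  · simp [subdiagOne]
  · intro i j hij
    have hij' : (i : ℕ) < j := hij
    simp only [subdiagOne, Matrix.sub_apply, one_apply, of_apply, Fin.ext_iff]
    split_ifs <;> first | omega | norm_num

lemma four_sub_Bmat_mul_transpose (k : ℕ) :
    (4 : ℚ) • (1 : Matrix (Fin k) (Fin k) ℚ) - Bmat k * (Bmat k)ᵀ =
      (1 - subdiagOne k) *
        (1 + allOnes (Fin k) (Fin 1) * ((2 : ℚ) • (allOnes (Fin k) (Fin 1))ᵀ)) *
        (1 - subdiagOne k)ᵀ := by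
  have h := subdiagOne_mul_transpose k
  rw [Bmat_eq_neg]
  simp only [transpose_mul, transpose_neg, transpose_add, transpose_sub, transpose_one,
    Matrix.mul_add, Matrix.add_mul, Matrix.mul_sub, Matrix.sub_mul, Matrix.mul_one,
    Matrix.one_mul, Matrix.neg_mul, Matrix.mul_neg, Matrix.mul_smul, Matrix.smul_mul,
    Matrix.mul_assoc] at h ⊢
  linear_combination (norm := module) (-2 : ℚ) • h

lemma det_four_sub_Bmat_mul_transpose (k : ℕ) :
    ((4 : ℚ) • (1 : Matrix (Fin k) (Fin k) ℚ) - Bmat k * (Bmat k)ᵀ).det = 2 * k + 1 := by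
  rw [four_sub_Bmat_mul_transpose, det_mul, det_mul, det_transpose, det_one_sub_subdiagOne,
    det_one_add_mul_comm]
  simp [allOnes, mul_apply]
  ring

lemma det_pathBlock (k : ℕ) : (pathBlock k).det = 2 * k + 1 := by
  have h : pathBlock k * fromBlocks 1 0 ((1 / 2 : ℚ) • (Bmat k)ᵀ) 1 =
      fromBlocks ((-1 / 2 : ℚ) • ((4 : ℚ) • (1 : Matrix (Fin k) (Fin k) ℚ) - Bmat k * (Bmat k)ᵀ))
        (Bmat k) 0 ((-2 : ℚ) • (1 : Matrix (Fin k) (Fin k) ℚ)) := by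
    rw [fromBlocks_multiply]
    congr 1
    · simp only [Matrix.mul_one, Matrix.mul_smul]
      module
    · simp
    · simp only [Matrix.mul_one, Matrix.mul_smul, Matrix.smul_mul, Matrix.one_mul]
      module
    · simp
  have h' := congrArg det h
  rw [det_mul, det_fromBlocks_zero₁₂, det_fromBlocks_zero₂₁, det_smul, det_smul,
    det_four_sub_Bmat_mul_transpose] at h'
  simp only [det_one, mul_one, Fintype.card_fin] at h'
  rw [h', mul_right_comm, ← mul_pow]
  norm_num

/-- The solution of `pathBlock k *ᵥ x = 1`. -/
def pathSolution (k : ℕ) : Fin k ⊕ Fin k → ℚ :=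
  Sum.elim (fun i => ((i : ℕ) - k : ℚ) / (2 * k + 1)) (fun i => -((i : ℕ) + 1 : ℚ) / (2 * k + 1))

lemma pathBlock_mulVec_pathSolution (k : ℕ) : pathBlock k *ᵥ pathSolution k = 1 := by
  have hk : (2 * k + 1 : ℚ) ≠ 0 := by positivity
  have hB := subdiagOne_mulVec k (fun i => -((i : ℕ) + 1 : ℚ) / (2 * k + 1))
  have hBt := subdiagOne_transpose_mulVec k (fun i => ((i : ℕ) - k : ℚ) / (2 * k + 1))
  rw [pathSolution, fromBlocks_mulVec, Bmat_eq_neg]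
  ext (i | i)
  · simp only [Sum.elim_inl, Pi.add_apply, Pi.one_apply, Pi.neg_apply, Pi.smul_apply,
      Sum.elim_comp_inl, Sum.elim_comp_inr, smul_mulVec, one_mulVec, neg_mulVec, add_mulVec,
      hB, smul_eq_mul]
    obtain ⟨_ | i, hi⟩ := i
    · simp; field_simp
    · simp; field_simp; ring
  · simp only [Sum.elim_inr, Pi.add_apply, Pi.one_apply, Pi.neg_apply, Pi.smul_apply,
      Sum.elim_comp_inl, Sum.elim_comp_inr, smul_mulVec, one_mulVec, neg_mulVec, add_mulVec,
      transpose_neg, transpose_add, transpose_one, hBt, smul_eq_mul]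
    split_ifs with hi
    · push_cast; field_simp; ring
    · have : (k : ℚ) = (i : ℕ) + 1 := by exact_mod_cast (by omega : k = (i : ℕ) + 1)
      rw [this] at hk ⊢
      field_simp; ring

lemma sum_pathSolution (k : ℕ) :
    ∑ i, pathSolution k i = -((k : ℚ) * (k + 1)) / (2 * k + 1) := by
  have hsum : ∀ n : ℕ, ∑ i ∈ Finset.range n, (i : ℚ) = n * (n - 1) / 2 := by
    intro n
    induction n with
    | zero => simp
    | succ n ih => rw [Finset.sum_range_succ, ih]; push_cast; ring
  simp only [pathSolution, Fintype.sum_sum_type, Sum.elim_inl, Sum.elim_inr]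
  rw [← Finset.sum_div, ← Finset.sum_div, ← add_div, Finset.sum_neg_distrib,
    Finset.sum_sub_distrib, Finset.sum_add_distrib,
    Fin.sum_univ_eq_sum_range (fun i => (i : ℚ)) k, hsum]
  simp
  ring

/-- Bordering a matrix `D` by all-ones vectors, where `D *ᵥ x = 1`. -/
lemma det_fromBlocks_allOnes {n : Type*} [Fintype n] [DecidableEq n] (D : Matrix n n ℚ)
    (x : n → ℚ) (hx : D *ᵥ x = 1) :
    (fromBlocks (0 : Matrix (Fin 1) (Fin 1) ℚ) (allOnes (Fin 1) n) (allOnes n (Fin 1)) D).det =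
      -(∑ i, x i) * D.det := by
  have h : fromBlocks (0 : Matrix (Fin 1) (Fin 1) ℚ) (allOnes (Fin 1) n) (allOnes n (Fin 1)) D *
      fromBlocks 1 0 (-replicateCol (Fin 1) x) 1 =
      fromBlocks (Matrix.of fun _ _ => -∑ i, x i) (allOnes (Fin 1) n) 0 D := by
    rw [fromBlocks_multiply]
    congr 1
    · ext i j
      simp [allOnes, mul_apply]
    · simp
    · rw [Matrix.mul_neg, ← replicateCol_mulVec, hx]
      ext i j
      simp [allOnes]
    · simp
  have h' := congrArg det h
  rw [det_mul, det_fromBlocks_zero₁₂, det_fromBlocks_zero₂₁] at h'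
  simpa using h'

/-- For `k, h ≥ 1`,
`det [[0, 𝟏, 𝟏, 𝟏, 𝟏], [𝟏ᵀ, -2I_k, B_k, 0, 0], [𝟏ᵀ, B_kᵀ, -2I_k, 0, 0],
      [𝟏ᵀ, 0, 0, -2I_h, B_h], [𝟏ᵀ, 0, 0, B_hᵀ, -2I_h]]
 = k(k+1)(2h+1) + h(h+1)(2k+1)`. -/
theorem det_block_D0 (k h : ℕ) (hk : 1 ≤ k) (hh : 1 ≤ h) :
    (Matrix.fromBlocks (0 : Matrix (Fin 1) (Fin 1) ℚ)
      (allOnes (Fin 1) ((Fin k ⊕ Fin k) ⊕ (Fin h ⊕ Fin h)))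
      (allOnes ((Fin k ⊕ Fin k) ⊕ (Fin h ⊕ Fin h)) (Fin 1))
      (Matrix.fromBlocks
        (Matrix.fromBlocks ((-2 : ℚ) • (1 : Matrix (Fin k) (Fin k) ℚ)) (Bmat k)
          (Bmat k)ᵀ ((-2 : ℚ) • (1 : Matrix (Fin k) (Fin k) ℚ)))
        0 0
        (Matrix.fromBlocks ((-2 : ℚ) • (1 : Matrix (Fin h) (Fin h) ℚ)) (Bmat h)
          (Bmat h)ᵀ ((-2 : ℚ) • (1 : Matrix (Fin h) (Fin h) ℚ))))).det =
    (k : ℚ) * ((k : ℚ) + 1) * (2 * (h : ℚ) + 1)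
      + (h : ℚ) * ((h : ℚ) + 1) * (2 * (k : ℚ) + 1) := by
  have hx : fromBlocks (pathBlock k) 0 0 (pathBlock h) *ᵥ
      Sum.elim (pathSolution k) (pathSolution h) = 1 := by
    rw [fromBlocks_mulVec]
    ext (i | i) <;> simp [pathBlock_mulVec_pathSolution]
  rw [det_fromBlocks_allOnes _ _ hx, det_fromBlocks_zero₂₁, det_pathBlock, det_pathBlock,
    Fintype.sum_sum_type]
  simp only [Sum.elim_inl, Sum.elim_inr, sum_pathSolution]
  field_simp
  ring
end

section
/- For every tree T on n ≥ 2 vertices, the determinant of the distance matrix of T equals (−1)^{n−1}·(n−1)·2^{n−2}. -/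
open SimpleGraph Matrix

theorem SimpleGraph.IsAcyclic.length_eq_dist {V : Type*} {G : SimpleGraph V} (hG : G.IsAcyclic)
    {u v : V} {p : G.Walk u v} (hp : p.IsPath) : p.length = G.dist u v := by
  obtain ⟨q, hq, hlen⟩ := p.reachable.exists_path_of_dist
  have h : (⟨p, hp⟩ : G.Path u v) = ⟨q, hq⟩ := (hG.subsingleton_path u v).elim _ _
  rw [← hlen, Subtype.mk.inj h]

theorem SimpleGraph.Connected.dist_induce_of_isAcyclic {V : Type*} {G : SimpleGraph V}
    (hG : G.IsAcyclic) {s : Set V} (hs : (G.induce s).Connected) (u v : s) :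
    (G.induce s).dist u v = G.dist u v := by
  obtain ⟨p, hp, hlen⟩ := hs.exists_path_of_dist u v
  have h := hG.length_eq_dist (hp.map (f := (Embedding.induce (G := G) s).toHom)
    (Embedding.induce (G := G) s).injective)
  rw [Walk.length_map, hlen] at h
  exact h

theorem SimpleGraph.Connected.dist_eq_dist_add_one_of_forall_adj_eq {V : Type*}
    {G : SimpleGraph V} (hG : G.Connected) {v p w : V} (hp : G.Adj v p)
    (huniq : ∀ u, G.Adj v u → u = p) (hw : w ≠ v) : G.dist v w = G.dist p w + 1 := by
  refine le_antisymm ?_ ?_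
  · have := hG.dist_triangle (u := v) (v := p) (w := w)
    rw [dist_eq_one_iff_adj.mpr hp] at this
    omega
  · obtain ⟨q, hq⟩ := hG.exists_walk_length_eq_dist v w
    rw [← hq]
    cases q with
    | nil => exact absurd rfl hw
    | cons h q =>
      obtain rfl := huniq _ h
      simpa using dist_le q

/-- Subtracting from the row and column of a new index those of `p` reduces the
determinant of the enlarged matrix to a Schur complement. -/
theorem Matrix.det_fromBlocks_add_one {n K : Type*} [Fintype n] [DecidableEq n] [Field K]
    [NeZero (2 : K)] (M : Matrix n n K) (p : n) :
    (fromBlocks M (of fun i (_ : Unit) => M i p + 1) (of fun (_ : Unit) j => M p j + 1)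
      (of fun _ _ => M p p)).det = -2 * (M + of fun _ _ => 2⁻¹).det := by
  have h2 : (2 : K) ≠ 0 := two_ne_zero
  let r : Matrix Unit n K := of fun _ => Pi.single p 1
  let N : Matrix (n ⊕ Unit) (n ⊕ Unit) K :=
    fromBlocks M (of fun _ _ => 1) (of fun _ _ => 1) (of fun _ _ => -2)
  have hfac : fromBlocks M (of fun i (_ : Unit) => M i p + 1)
      (of fun (_ : Unit) j => M p j + 1) (of fun _ _ => M p p) =
      fromBlocks 1 0 r 1 * N * fromBlocks 1 rᵀ 0 1 := by
    simp only [N, fromBlocks_multiply]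
    congr 1 <;> ext i j <;> simp [r, mul_apply, Pi.single_apply] <;> ring
  have hinv : Invertible (of fun _ _ => -2 : Matrix Unit Unit K) := by
    refine ⟨of fun _ _ => -2⁻¹, ?_, ?_⟩ <;> ext <;> simp [mul_apply, h2]
  have hinvOf : ⅟(of fun _ _ => -2 : Matrix Unit Unit K) = of fun _ _ => -2⁻¹ :=
    invOf_eq_right_inv (by ext; simp [mul_apply, h2])
  rw [hfac, det_mul, det_mul, det_fromBlocks_zero₁₂, det_fromBlocks_zero₂₁, det_fromBlocks₂₂,
    hinvOf]
  simp only [det_one, one_mul, mul_one]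
  rw [det_unique, of_apply]
  congr 2
  ext
  simp [mul_apply]

/-- Adding `x` to every entry of the distance matrix makes the Graham–Pollack formula amenable to
induction: removing a leaf multiplies the determinant by `-2` and shifts `x` by `1 / 2`. -/
theorem det_distMatrix_add_const {V : Type*} [Fintype V] [DecidableEq V]
    (T : SimpleGraph V) (hT : T.IsTree) (x : ℚ) :
    (distMatrix T + of fun _ _ => x).det =
      (-2) ^ (Fintype.card V - 1) * (((Fintype.card V : ℚ) - 1) / 2 + x) := by
  induction hn : Fintype.card V using Nat.strong_induction_on generalizing V x with
  | _ n ih =>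
  classical
  have := hT.connected.nonempty
  rcases subsingleton_or_nontrivial V with hV | hV
  · have : Inhabited V := Classical.inhabited_of_nonempty ‹_›
    have : Unique V := Unique.mk' V
    simp [← hn, det_unique, distMatrix]
  obtain ⟨v, hv⟩ := hT.exists_vert_degree_one_of_nontrivial
  obtain ⟨p, hp, huniq⟩ := degree_eq_one_iff_existsUnique_adj.mp hv
  have hconn := hT.connected.induce_compl_singleton_of_degree_eq_one hv
  have hcard : Fintype.card ({v}ᶜ : Set V) = n - 1 := by
    rw [Fintype.card_compl_set, hn]; simp
  have hn1 : 1 < n := hn ▸ Fintype.one_lt_card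
  have ih' := ih (n - 1) (by omega) (T.induce {v}ᶜ) ⟨hconn, hT.isAcyclic.induce _⟩ (x + 2⁻¹) hcard
  let e : ({v}ᶜ : Set V) ⊕ Unit ≃ V :=
    (Equiv.optionEquivSumPUnit _).symm.trans (Equiv.optionSubtypeNe v)
  have he_inl (i) : e (Sum.inl i) = i := rfl
  have he_inr (i) : e (Sum.inr i) = v := rfl
  let M := distMatrix (T.induce {v}ᶜ) + of fun _ _ => x
  have hdist (w : V) (hw : w ≠ v) : T.dist v w = T.dist p w + 1 :=
    hT.connected.dist_eq_dist_add_one_of_forall_adj_eq hp huniq hw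
  have hblocks : (distMatrix T + of fun _ _ => x).submatrix e e =
      fromBlocks M (of fun i (_ : Unit) => M i ⟨p, hp.ne'⟩ + 1)
        (of fun (_ : Unit) j => M ⟨p, hp.ne'⟩ j + 1) (of fun _ _ => M ⟨p, hp.ne'⟩ ⟨p, hp.ne'⟩) := by
    have hi := hconn.dist_induce_of_isAcyclic hT.isAcyclic
    ext (⟨i, hi'⟩ | i) (⟨j, hj'⟩ | j)
    · simp [M, he_inl, distMatrix, hi]
    · simp [M, he_inl, he_inr, distMatrix, hi, T.dist_comm (u := i), hdist i hi']
      ring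
    · simp [M, he_inl, he_inr, distMatrix, hi, hdist j hj']
      ring
    · simp [M, he_inr, distMatrix]
  have hM : M + of (fun _ _ => 2⁻¹) =
      distMatrix (T.induce {v}ᶜ) + of fun _ _ => x + 2⁻¹ := add_assoc _ _ _
  rw [← det_submatrix_equiv_self e, hblocks, det_fromBlocks_add_one, hM, ih']
  obtain ⟨k, rfl⟩ := Nat.exists_eq_add_of_le' hn1
  simp [pow_succ]
  ring

/-- Graham–Pollack: for every tree `T` on `n ≥ 2` vertices, the determinant of
the distance matrix of `T` equals `(-1)^(n-1) (n-1) 2^(n-2)`. -/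
theorem det_distMatrix_tree {V : Type*} [Fintype V] [DecidableEq V]
    (T : SimpleGraph V) (hT : T.IsTree) (hn : 2 ≤ Fintype.card V) :
    (distMatrix T).det =
      (-1 : ℚ) ^ (Fintype.card V - 1) * ((Fintype.card V : ℚ) - 1) *
        2 ^ (Fintype.card V - 2) := by
  have h := det_distMatrix_add_const T hT 0
  rw [show (of fun _ _ => 0 : Matrix V V ℚ) = 0 from rfl, add_zero] at h
  obtain ⟨k, hk⟩ := Nat.exists_eq_add_of_le' hn
  rw [h, hk, neg_pow]
  simp [pow_succ]
  ring
end

section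
/- Let p ≥ 3 and n ≥ 0 be integers, and let G be a unicyclic graph on p+n vertices whose unique cycle has length p (equivalently, G contains an induced cycle of length p). If p is even, then the determinant of the distance matrix of G equals 0; if p is odd, then the determinant of the distance matrix of G equals ((p−1)(p+1)/4 + (n/2)·p)·(−2)^n (as a rational number). -/
open SimpleGraph Matrix

/-- The permutation matrix of the translation by `k` on `ZMod p`. -/
def shiftMatrix {p : ℕ} (k : ZMod p) : Matrix (ZMod p) (ZMod p) ℚ :=
  Matrix.of fun i j => if j = i + k then 1 else 0

/-- The square matrix all of whose entries are `1`. -/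
def onesMatrix (W : Type*) : Matrix W W ℚ := Matrix.of fun _ _ => 1

theorem det_one_add_smul_onesMatrix {W : Type*} [Fintype W] [DecidableEq W] (s : ℚ) :
    (1 + s • onesMatrix W).det = 1 + s * Fintype.card W := by
  have h : s • onesMatrix W =
      replicateCol Unit (fun _ : W => s) * replicateRow Unit (fun _ : W => (1 : ℚ)) := by
    ext i j
    simp [onesMatrix, Matrix.mul_apply]
  rw [h, det_one_add_replicateCol_mul_replicateRow]
  simp [dotProduct, mul_comm]

theorem onesMatrix_mul_onesMatrix {W : Type*} [Fintype W] :
    onesMatrix W * onesMatrix W = (Fintype.card W : ℚ) • onesMatrix W := by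
  ext i j
  simp [onesMatrix, Matrix.mul_apply]

theorem shiftMatrix_zero {p : ℕ} : shiftMatrix (0 : ZMod p) = 1 := by
  ext i j
  simp [shiftMatrix, Matrix.one_apply, eq_comm]

theorem shiftMatrix_transpose {p : ℕ} (k : ZMod p) : (shiftMatrix k)ᵀ = shiftMatrix (-k) := by
  ext i j
  simp only [shiftMatrix, transpose_apply, of_apply, ← sub_eq_add_neg, eq_sub_iff_add_eq]
  simp only [eq_comm]

section Shift

variable {p : ℕ} [NeZero p]

theorem mul_shiftMatrix_apply (M : Matrix (ZMod p) (ZMod p) ℚ) (k i j : ZMod p) :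
    (M * shiftMatrix k) i j = M i (j - k) := by
  simp [shiftMatrix, Matrix.mul_apply, ← sub_eq_iff_eq_add]

theorem shiftMatrix_mul_apply (M : Matrix (ZMod p) (ZMod p) ℚ) (k i j : ZMod p) :
    (shiftMatrix k * M) i j = M (i + k) j := by
  simp [shiftMatrix, Matrix.mul_apply]

theorem shiftMatrix_mul_shiftMatrix (k l : ZMod p) :
    shiftMatrix k * shiftMatrix l = shiftMatrix (k + l) := by
  ext i j
  rw [shiftMatrix_mul_apply]
  simp [shiftMatrix, add_assoc]

theorem shiftMatrix_mul_onesMatrix (k : ZMod p) :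
    shiftMatrix k * onesMatrix (ZMod p) = onesMatrix (ZMod p) := by
  ext i j
  rw [shiftMatrix_mul_apply]
  rfl

theorem det_shiftMatrix_sub_one_add_smul (k : ZMod p) (c : ℚ) :
    (shiftMatrix k - 1 + c • onesMatrix (ZMod p)).det =
      c * (shiftMatrix k - 1 + onesMatrix (ZMod p)).det := by
  have hp : (p : ℚ) ≠ 0 := NeZero.ne _
  have h : shiftMatrix k - 1 + c • onesMatrix (ZMod p) =
      (shiftMatrix k - 1 + onesMatrix (ZMod p)) *
        (1 + ((c - 1) / p) • onesMatrix (ZMod p)) := by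
    rw [Matrix.mul_add, Matrix.mul_one, Matrix.mul_smul, Matrix.add_mul, Matrix.sub_mul,
      shiftMatrix_mul_onesMatrix, onesMatrix_mul_onesMatrix, Matrix.one_mul, sub_self, zero_add,
      smul_smul, ZMod.card, div_mul_cancel₀ _ hp, sub_smul, one_smul]
    abel
  rw [h, det_mul, det_one_add_smul_onesMatrix, ZMod.card, div_mul_cancel₀ _ hp]
  ring

theorem det_shiftMatrix_sub_one_add_ne_zero {k : ZMod p} (hk : IsUnit k) :
    (shiftMatrix k - 1 + onesMatrix (ZMod p)).det ≠ 0 := by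
  have hp : (p : ℚ) ≠ 0 := NeZero.ne _
  intro h
  obtain ⟨x, hx, hMx⟩ := Matrix.exists_mulVec_eq_zero_iff.mpr h
  have hrow (i : ZMod p) : x (i + k) - x i + ∑ j, x j = 0 := by
    have := congrFun hMx i
    rw [Matrix.add_mulVec, Matrix.sub_mulVec, Matrix.one_mulVec] at this
    simpa [Matrix.mulVec, dotProduct, shiftMatrix, onesMatrix] using this
  have hshift : ∑ i, x (i + k) = ∑ i, x i := Equiv.sum_comp (Equiv.addRight k) x
  have hsum : ∑ j, x j = 0 := by
    have h1 : ∑ i, (x (i + k) - x i + ∑ j, x j) = 0 := Finset.sum_eq_zero fun i _ => hrow i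
    rw [Finset.sum_add_distrib, Finset.sum_sub_distrib, hshift, sub_self, zero_add,
      Finset.sum_const, Finset.card_univ, ZMod.card, nsmul_eq_mul] at h1
    exact (mul_eq_zero.mp h1).resolve_left hp
  have hstep (i : ZMod p) : x (i + k) = x i := by linarith [hrow i]
  have hmul (n : ℕ) : x (n * k) = x 0 := by
    induction n with
    | zero => simp
    | succ n ih => rw [Nat.cast_succ, add_mul, one_mul, hstep, ih]
  have hconst (i : ZMod p) : x i = x 0 := by
    obtain ⟨u, rfl⟩ := hk
    have := hmul (i * (↑u⁻¹ : ZMod p)).val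
    rwa [ZMod.natCast_val, ZMod.cast_id', id, Units.inv_mul_cancel_right] at this
  have h0 : x 0 = 0 := by
    simp_rw [hconst, Finset.sum_const, Finset.card_univ, ZMod.card, nsmul_eq_mul] at hsum
    exact (mul_eq_zero.mp hsum).resolve_left hp
  exact hx (funext fun i => (hconst i).trans h0)

theorem det_one_add_shiftMatrix {k : ZMod p} (hk : IsUnit k) (h2 : IsUnit (2 : ZMod p)) :
    (1 + shiftMatrix k).det = 2 := by
  have hmul : (1 + shiftMatrix k) * (shiftMatrix k - 1 + onesMatrix (ZMod p)) =
      shiftMatrix (2 * k) - 1 + (2 : ℚ) • onesMatrix (ZMod p) := by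
    rw [Matrix.add_mul, Matrix.one_mul, Matrix.mul_add, Matrix.mul_sub, Matrix.mul_one,
      shiftMatrix_mul_shiftMatrix, shiftMatrix_mul_onesMatrix, two_smul, two_mul]
    abel
  have hconj : (shiftMatrix (2 * k) - 1 + (2 : ℚ) • onesMatrix (ZMod p)).det =
      (shiftMatrix k - 1 + (2 : ℚ) • onesMatrix (ZMod p)).det := by
    obtain ⟨u, hu⟩ := h2
    rw [← det_submatrix_equiv_self (Units.mulLeft u)]
    congr 1
    ext i j
    simp [shiftMatrix, onesMatrix, Matrix.one_apply, ← hu, ← mul_add]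
  have hdet := congrArg Matrix.det hmul
  rw [det_mul, hconj, det_shiftMatrix_sub_one_add_smul] at hdet
  exact mul_right_cancel₀ (det_shiftMatrix_sub_one_add_ne_zero hk) hdet

theorem natAbs_valMinAbs_natCast {a : ℕ} (ha : a < 2 * p) :
    (a : ZMod p).valMinAbs.natAbs = if a < p then min a (p - a) else min (a - p) (2 * p - a) := by
  rw [ZMod.valMinAbs_natAbs_eq_min, ZMod.val_natCast]
  split_ifs with h
  · rw [Nat.mod_eq_of_lt h]
  · rw [Nat.mod_eq_sub_mod (by omega), Nat.mod_eq_of_lt (by omega)]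
    congr 1
    omega

end Shift

/-- The determinant of the distance matrix of an odd cycle, shifted by a constant. -/
theorem det_cycle_of_odd {p : ℕ} [NeZero p] (hp : Odd p) (t : ℚ) :
    (Matrix.of fun i j : ZMod p => (((j - i).valMinAbs.natAbs : ℕ) : ℚ) + t).det =
      ((p : ℚ) - 1) * (p + 1) / 4 + t * p := by
  obtain ⟨m, hm⟩ := hp
  have hp0 : (p : ZMod p) = 0 := ZMod.natCast_self p
  have hm2 : (2 : ZMod p) * -m = 1 := by
    have : ((2 * m + 1 : ℕ) : ZMod p) = 0 := by rw [← hm, hp0]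
    push_cast at this
    linear_combination -this
  have h2 : IsUnit (2 : ZMod p) := IsUnit.of_mul_eq_one _ hm2
  have hk : IsUnit (m : ZMod p) := IsUnit.of_mul_eq_one (-2 : ZMod p) (by linear_combination hm2)
  set k : ZMod p := (m : ZMod p) with hkdef
  set M : Matrix (ZMod p) (ZMod p) ℚ :=
    Matrix.of fun i j : ZMod p => (((j - i).valMinAbs.natAbs : ℕ) : ℚ) + t with hM
  have hfun (x : ZMod p) : 2 * x.valMinAbs.natAbs + (x + k).valMinAbs.natAbs +
      (x - k).valMinAbs.natAbs + (if x = 0 then 1 else 0) = p := by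
    obtain ⟨a, ha, rfl⟩ : ∃ a < p, (a : ZMod p) = x :=
      ⟨x.val, ZMod.val_lt x, by simp⟩
    have h1 : (a : ZMod p) - k = ((a + (m + 1) : ℕ) : ZMod p) := by
      push_cast
      linear_combination hm2
    rw [h1, hkdef, ← Nat.cast_add, natAbs_valMinAbs_natCast (by omega),
      natAbs_valMinAbs_natCast (by omega), natAbs_valMinAbs_natCast (by omega)]
    have h0 : (a : ZMod p) = 0 ↔ a = 0 :=
      ⟨fun h => Nat.eq_zero_of_dvd_of_lt ((ZMod.natCast_eq_zero_iff _ _).mp h) ha,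
        fun h => by simp [h]⟩
    simp only [h0]
    split_ifs <;> omega
  have hB : (1 + shiftMatrix k) * (1 + shiftMatrix k)ᵀ =
      (2 : ℚ) • 1 + shiftMatrix k + shiftMatrix (-k) := by
    rw [transpose_add, transpose_one, shiftMatrix_transpose, Matrix.add_mul, Matrix.mul_add,
      Matrix.mul_add, Matrix.one_mul, Matrix.one_mul, Matrix.mul_one, shiftMatrix_mul_shiftMatrix,
      add_neg_cancel, shiftMatrix_zero, two_smul]
    abel
  have hMB : M * ((1 + shiftMatrix k) * (1 + shiftMatrix k)ᵀ) =
      -(1 + (-(p + 4 * t)) • onesMatrix (ZMod p)) := by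
    rw [hB, Matrix.mul_add, Matrix.mul_add, Matrix.mul_smul, Matrix.mul_one]
    ext i j
    rw [Matrix.add_apply, Matrix.add_apply, mul_shiftMatrix_apply, mul_shiftMatrix_apply]
    have h := congrArg (Nat.cast : ℕ → ℚ) (hfun (j - i))
    rw [show j - i + k = j - -k - i by ring, show j - i - k = j - k - i by ring] at h
    simp only [sub_eq_zero, eq_comm (a := j)] at h
    push_cast at h
    simp only [hM, onesMatrix, Matrix.smul_apply, Matrix.of_apply, Matrix.neg_apply,
      Matrix.add_apply, Matrix.one_apply, smul_eq_mul]
    linear_combination h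
  have hdet := congrArg Matrix.det hMB
  rw [det_mul, det_mul, det_transpose, det_one_add_shiftMatrix hk h2, det_neg,
    det_one_add_smul_onesMatrix, ZMod.card, Odd.neg_one_pow ⟨m, hm⟩] at hdet
  linear_combination hdet / 4

/-- The shifted distance matrix of an even cycle is singular. -/
theorem det_cycle_of_even {p : ℕ} (hp3 : 3 ≤ p) [NeZero p] (hp : Even p) (t : ℚ) :
    (Matrix.of fun i j : ZMod p => (((j - i).valMinAbs.natAbs : ℕ) : ℚ) + t).det = 0 := by
  obtain ⟨m, hm⟩ := hp
  have hfun (x : ZMod p) : x.valMinAbs.natAbs + (x - m).valMinAbs.natAbs = m := by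
    obtain ⟨a, ha, rfl⟩ : ∃ a < p, (a : ZMod p) = x :=
      ⟨x.val, ZMod.val_lt x, by simp⟩
    have h1 : (a : ZMod p) - m = ((a + m : ℕ) : ZMod p) := by
      have : ((m + m : ℕ) : ZMod p) = 0 := by rw [← hm, ZMod.natCast_self]
      push_cast at this ⊢
      linear_combination -this
    rw [h1, natAbs_valMinAbs_natCast (by omega), natAbs_valMinAbs_natCast (by omega)]
    split_ifs <;> omega
  rw [← Matrix.exists_vecMul_eq_zero_iff]
  let e : ZMod p → ZMod p → ℚ := fun i => Pi.single i 1
  refine ⟨e 0 + e m - e 1 - e (1 + m), ?_, ?_⟩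
  · have hne (a : ℕ) (ha : 0 < a) (hap : a < p) : (0 : ZMod p) ≠ a := fun h =>
      absurd (Nat.le_of_dvd ha ((ZMod.natCast_eq_zero_iff _ _).mp h.symm)) (by omega)
    intro h
    have h0 := congrFun h 0
    have h1 := hne 1 (by omega) (by omega)
    have h2 := hne m (by omega) (by omega)
    have h3 := hne (1 + m) (by omega) (by omega)
    push_cast at h1 h3
    simp [e, h1, h2, h3] at h0
  · ext j
    have h := congrArg (Nat.cast : ℕ → ℚ) ((hfun (j - 0)).trans (hfun (j - 1)).symm)
    rw [show j - 0 - (m : ZMod p) = j - m by ring,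
      show j - 1 - (m : ZMod p) = j - (1 + m) by ring] at h
    push_cast at h
    simp only [e, Matrix.sub_vecMul, Matrix.add_vecMul, Matrix.single_one_vecMul, Pi.sub_apply,
      Pi.add_apply, Matrix.row_apply, Matrix.of_apply, Pi.zero_apply]
    linear_combination h

/-- Bordering `A` by a copy of the row and column `u`, increased by one off the diagonal. -/
theorem det_fromBlocks_leaf {W : Type*} [Fintype W] [DecidableEq W] (A : Matrix W W ℚ) (u : W) :
    (fromBlocks A (Matrix.of fun x (_ : Unit) => A x u + 1)
      (Matrix.of fun (_ : Unit) x => A u x + 1) (Matrix.of fun _ _ => A u u)).det =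
      -2 * (A + (1 / 2 : ℚ) • onesMatrix W).det := by
  set L : Matrix (W ⊕ Unit) (W ⊕ Unit) ℚ :=
    fromBlocks 1 0 (Matrix.of fun _ x => if x = u then 1 else 0) 1 with hL
  have hfac : fromBlocks A (Matrix.of fun x (_ : Unit) => A x u + 1)
      (Matrix.of fun (_ : Unit) x => A u x + 1) (Matrix.of fun _ _ => A u u) =
      L * fromBlocks A (Matrix.of fun _ _ => 1) (Matrix.of fun _ _ => 1)
        ((-2 : ℚ) • (1 : Matrix Unit Unit ℚ)) * Lᵀ := by
    rw [hL, fromBlocks_transpose, fromBlocks_multiply, fromBlocks_multiply, fromBlocks_inj]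
    refine ⟨?_, ?_, ?_, ?_⟩ <;> ext i j <;> simp [Matrix.mul_apply, Matrix.add_apply]
    ring
  have hLdet : L.det = 1 := by rw [hL, det_fromBlocks_zero₁₂, det_one, det_one, one_mul]
  let : Invertible ((-2 : ℚ) • (1 : Matrix Unit Unit ℚ)) :=
    invertibleOfLeftInverse _ ((-1 / 2 : ℚ) • 1) (by norm_num [smul_smul])
  rw [hfac, det_mul, det_mul, det_transpose, hLdet, one_mul, mul_one, det_fromBlocks₂₂]
  congr 1
  · simp
  · congr 1
    ext i j
    have : ⅟((-2 : ℚ) • (1 : Matrix Unit Unit ℚ)) = (-1 / 2 : ℚ) • 1 := rfl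
    rw [this]
    simp [Matrix.mul_apply, onesMatrix]
    ring

theorem dist_circulantGraph_one {p : ℕ} (hp : 2 ≤ p) [NeZero p] (i j : ZMod p) :
    (circulantGraph ({1} : Set (ZMod p))).dist i j = (j - i).valMinAbs.natAbs := by
  set C := circulantGraph ({1} : Set (ZMod p)) with hC
  have : Fact (1 < p) := ⟨hp⟩
  have hone : (1 : ZMod p).valMinAbs.natAbs ≤ 1 := by
    rw [ZMod.valMinAbs_natAbs_eq_min, ZMod.val_one]
    exact min_le_left _ _
  have hlower {a b : ZMod p} (w : C.Walk a b) : (b - a).valMinAbs.natAbs ≤ w.length := by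
    induction w with
    | nil => simp
    | @cons a b c h w ih =>
      have hab : (b - a).valMinAbs.natAbs ≤ 1 := by
        rw [hC, circulantGraph_adj] at h
        obtain ⟨-, h | h⟩ := h
        · rw [← ZMod.natAbs_valMinAbs_neg, neg_sub, Set.mem_singleton_iff.mp h]
          exact hone
        · rw [Set.mem_singleton_iff.mp h]
          exact hone
      have hadd := (ZMod.natAbs_valMinAbs_add_le (c - b) (b - a)).trans (Int.natAbs_add_le _ _)
      rw [sub_add_sub_cancel] at hadd
      rw [Walk.length_cons]
      omega
  have hupper (a : ZMod p) (n : ℕ) : ∃ w : C.Walk a (a + n), w.length = n := by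
    induction n with
    | zero => exact ⟨Walk.nil.copy rfl (by simp), by simp⟩
    | succ n ih =>
      obtain ⟨w, hw⟩ := ih
      have hadj : C.Adj (a + n) (a + (n + 1 : ℕ)) := by
        rw [hC, circulantGraph_adj]
        push_cast
        refine ⟨?_, Or.inr ?_⟩
        · rw [← add_assoc]
          simp
        · simp
      exact ⟨w.concat hadj, by simp [hw]⟩
  have hdist (a b : ZMod p) (n : ℕ) (h : (n : ZMod p) = b - a) :
      C.Reachable a b ∧ C.dist a b ≤ n := by
    obtain ⟨w, hw⟩ := hupper a n
    have hb : a + n = b := by rw [h, add_sub_cancel]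
    subst hb
    exact ⟨⟨w⟩, (dist_le w).trans hw.le⟩
  have hle : C.Reachable i j ∧ C.dist i j ≤ (j - i).valMinAbs.natAbs := by
    have h := ZMod.natCast_natAbs_valMinAbs (j - i)
    split_ifs at h
    · exact hdist i j _ h
    · rw [neg_sub] at h
      have := hdist j i _ h
      exact ⟨this.1.symm, dist_comm (G := C) ▸ this.2⟩
  obtain ⟨w, hw⟩ := hle.1.exists_walk_length_eq_dist
  exact le_antisymm hle.2 (hw ▸ hlower w)

namespace SimpleGraph

variable {V V' : Type*} {G : SimpleGraph V} {G' : SimpleGraph V'}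

theorem Iso.dist_apply (e : G ≃g G') (hG : G.Connected) (x y : V) :
    G'.dist (e x) (e y) = G.dist x y := by
  refine le_antisymm ?_ ?_
  · obtain ⟨w, hw⟩ := hG.exists_walk_length_eq_dist x y
    simpa [hw] using dist_le (w.map e.toHom)
  · obtain ⟨w, hw⟩ := (e.connected_iff.mp hG).exists_walk_length_eq_dist (e x) (e y)
    simpa [hw] using dist_le ((w.map e.symm.toHom).copy (e.symm_apply_apply x)
      (e.symm_apply_apply y))

theorem Connected.dist_leaf (hG : G.Connected) {u v x : V} (hvu : G.Adj v u)
    (hv : ∀ y, G.Adj v y → y = u) (hx : x ≠ v) : G.dist v x = G.dist u x + 1 := by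
  refine le_antisymm ?_ ?_
  · have h := hG.dist_triangle (u := v) (v := u) (w := x)
    rw [dist_eq_one_iff_adj.mpr hvu] at h
    omega
  · obtain ⟨w, hw⟩ := hG.exists_walk_length_eq_dist v x
    rw [← hw]
    cases w with
    | nil => exact absurd rfl hx
    | cons h w =>
      obtain rfl := hv _ h
      exact Nat.succ_le_succ (dist_le w)

theorem Connected.dist_induce_compl_leaf {u v : V} (hvu : G.Adj v u)
    (hv : ∀ y, G.Adj v y → y = u) (hH : (G.induce {v}ᶜ).Connected) (x y : ({v}ᶜ : Set V)) :
    (G.induce {v}ᶜ).dist x y = G.dist x y := by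
  classical
  set H := G.induce {v}ᶜ with hHdef
  refine le_antisymm ?_ ?_
  · let r : V → ({v}ᶜ : Set V) := fun z => if h : z = v then ⟨u, hvu.ne'⟩ else ⟨z, h⟩
    have hr (z : ({v}ᶜ : Set V)) : r z = z := dif_neg z.2
    have hstep {a b : V} (h : G.Adj a b) : H.dist (r a) (r b) ≤ 1 := by
      by_cases ha : a = v
      · subst ha
        obtain rfl := hv b h
        simp [r, h.ne']
      · by_cases hb : b = v
        · subst hb
          obtain rfl := hv a h.symm
          simp [r, h.ne]
        · refine (dist_eq_one_iff_adj.mpr ?_).le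
          simpa [r, ha, hb, hHdef] using h
    have hwalk {a b : V} (w : G.Walk a b) : H.dist (r a) (r b) ≤ w.length := by
      induction w with
      | nil => simp
      | @cons a b c h w ih =>
        have h1 := hH.dist_triangle (u := r a) (v := r b) (w := r c)
        have h2 := hstep h
        rw [Walk.length_cons]
        omega
    obtain ⟨w⟩ := hH.preconnected x y
    have hreach : G.Reachable (x : V) y := ⟨w.map (Embedding.induce _).toHom⟩
    obtain ⟨w', hw'⟩ := hreach.exists_walk_length_eq_dist
    simpa [hr, hw'] using hwalk w'
  · obtain ⟨w, hw⟩ := hH.exists_walk_length_eq_dist x y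
    exact (dist_le (w.map (Embedding.induce _).toHom)).trans_eq ((Walk.length_map _ _).trans hw)

/-- An embedded cycle raises the degree of its vertices to at least two; in case of equality its
neighbors all lie on the cycle. -/
theorem two_le_degree_of_cycleGraph_embedding [Fintype V] [DecidableRel G.Adj] {q : ℕ}
    (f : cycleGraph (q + 3) ↪g G) (i : Fin (q + 3)) :
    2 ≤ G.degree (f i) ∧
      (G.degree (f i) = 2 → ∀ y, G.Adj (f i) y → y ∈ Set.range f) := by
  classical
  have hsub : ((cycleGraph (q + 3)).neighborFinset i).image f ⊆ G.neighborFinset (f i) := by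
    intro y hy
    obtain ⟨j, hj, rfl⟩ := Finset.mem_image.mp hy
    rw [mem_neighborFinset] at hj ⊢
    exact f.map_adj_iff.mpr hj
  have hcard : (((cycleGraph (q + 3)).neighborFinset i).image f).card = 2 := by
    rw [Finset.card_image_of_injective _ f.injective, card_neighborFinset_eq_degree,
      cycleGraph_degree_three_le]
  rw [← card_neighborFinset_eq_degree]
  refine ⟨hcard ▸ Finset.card_le_card hsub, fun h y hy => ?_⟩
  have heq := Finset.eq_of_subset_of_card_le hsub (by rw [h, hcard])
  rw [← mem_neighborFinset, ← heq] at hy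
  obtain ⟨j, -, rfl⟩ := Finset.mem_image.mp hy
  exact ⟨j, rfl⟩

theorem Connected.exists_degree_eq_one_of_unicyclic [Fintype V] [DecidableRel G.Adj]
    (hG : G.Connected) (hE : G.edgeFinset.card = Fintype.card V) {q : ℕ}
    (f : cycleGraph (q + 3) ↪g G) (hV : q + 3 < Fintype.card V) : ∃ v, G.degree v = 1 := by
  by_contra! hne
  have : Nontrivial V := Fintype.one_lt_card_iff_nontrivial.mp (by omega)
  have hge (v : V) : 2 ≤ G.degree v := by
    have := hG.preconnected.degree_pos_of_nontrivial v
    have := hne v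
    omega
  have hsum : ∑ _v : V, 2 = ∑ v, G.degree v := by
    rw [G.sum_degrees_eq_twice_card_edges, hE]
    simp [mul_comm]
  have hdeg (v : V) : 2 = G.degree v :=
    (Finset.sum_eq_sum_iff_of_le fun v _ => hge v).mp hsum v (Finset.mem_univ v)
  have hwalk {a b : V} (w : G.Walk a b) (ha : a ∈ Set.range f) : b ∈ Set.range f := by
    induction w with
    | nil => exact ha
    | cons h w ih =>
      obtain ⟨i, rfl⟩ := ha
      exact ih ((two_le_degree_of_cycleGraph_embedding f i).2 (hdeg _).symm _ h)
  have hsurj : Function.Surjective f := fun y =>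
    hwalk (hG.preconnected (f 0) y).some ⟨0, rfl⟩
  have := Fintype.card_le_of_surjective f hsurj
  rw [Fintype.card_fin] at this
  omega

end SimpleGraph

theorem det_dist_cycleGraph {q : ℕ} (t : ℚ) :
    (Matrix.of fun i j => ((cycleGraph (q + 3)).dist i j : ℚ) + t).det =
      (Matrix.of fun i j : ZMod (q + 3) => (((j - i).valMinAbs.natAbs : ℕ) : ℚ) + t).det := by
  simp_rw [← dist_circulantGraph_one (p := q + 3) (by omega), cycleGraph_eq_circulantGraph]
  rfl

/-- The determinant of a shifted distance matrix after removal of a leaf. -/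
theorem det_dist_add_leaf {V : Type*} [Fintype V] [DecidableEq V] {G : SimpleGraph V}
    (hG : G.Connected) {u v : V} (hvu : G.Adj v u) (hv : ∀ y, G.Adj v y → y = u)
    (hH : (G.induce {v}ᶜ).Connected) (t : ℚ) :
    (Matrix.of fun i j => (G.dist i j : ℚ) + t).det =
      -2 * (Matrix.of fun i j => ((G.induce {v}ᶜ).dist i j : ℚ) + (t + 1 / 2)).det := by
  let e : ({v}ᶜ : Set V) ⊕ Unit ≃ V := Equiv.ofBijective (Sum.elim Subtype.val fun _ => v) <| by
    refine ⟨Subtype.val_injective.sumElim (Function.injective_of_subsingleton _)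
      fun a _ => a.2, fun x => ?_⟩
    by_cases hx : x = v
    · exact ⟨Sum.inr (), hx.symm⟩
    · exact ⟨Sum.inl ⟨x, hx⟩, rfl⟩
  have hel (i : ({v}ᶜ : Set V)) : e (Sum.inl i) = i := rfl
  have her (i : Unit) : e (Sum.inr i) = v := rfl
  let A : Matrix ({v}ᶜ : Set V) ({v}ᶜ : Set V) ℚ :=
    Matrix.of fun i j => ((G.induce {v}ᶜ).dist i j : ℚ) + t
  have hA : (Matrix.of fun i j => ((G.induce {v}ᶜ).dist i j : ℚ) + (t + 1 / 2)) =
      A + (1 / 2 : ℚ) • onesMatrix _ := by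
    ext i j
    simp [A, onesMatrix, add_assoc]
  rw [hA, ← det_fromBlocks_leaf A ⟨u, hvu.ne'⟩, ← det_submatrix_equiv_self e]
  congr 1
  ext i j
  rcases i with i | i <;> rcases j with j | j
  · simp [hel, A, Connected.dist_induce_compl_leaf hvu hv hH]
  · have h := hG.dist_leaf hvu hv i.2
    rw [dist_comm (v := i.1), dist_comm (v := i.1)] at h
    simp [hel, her, A, Connected.dist_induce_compl_leaf hvu hv hH, h]
    ring
  · simp [hel, her, A, Connected.dist_induce_compl_leaf hvu hv hH, hG.dist_leaf hvu hv j.2]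
    ring
  · simp [her, A]

theorem det_dist_unicyclic {V : Type*} [Fintype V] [DecidableEq V] (q n : ℕ)
    (G : SimpleGraph V) (hG : G.Connected) (hcard : Fintype.card V = q + 3 + n)
    (hE : G.edgeSet.ncard = Fintype.card V) (f : cycleGraph (q + 3) ↪g G) (t : ℚ) :
    (Matrix.of fun i j => (G.dist i j : ℚ) + t).det =
      (-2) ^ n *
        (Matrix.of fun i j => ((cycleGraph (q + 3)).dist i j : ℚ) + (t + n / 2)).det := by
  classical
  induction n generalizing V t with
  | zero =>
    have hbij : Function.Bijective f :=
      (Fintype.bijective_iff_injective_and_card f).mpr ⟨f.injective, by simp [hcard]⟩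
    let e : cycleGraph (q + 3) ≃g G := RelIso.ofSurjective f hbij.2
    rw [← det_submatrix_equiv_self e.toEquiv]
    simp only [pow_zero, one_mul, Nat.cast_zero, zero_div, add_zero]
    congr 1
    ext i j
    have h : G.dist (e i) (e j) = _ := e.dist_apply cycleGraph_connected i j
    exact congrArg (fun d : ℕ => (d : ℚ) + t) h
  | succ n ih =>
    rw [Set.ncard_eq_toFinset_card'] at hE
    obtain ⟨v, hdeg⟩ := hG.exists_degree_eq_one_of_unicyclic hE f (by omega)
    obtain ⟨u, hvu, hv⟩ := degree_eq_one_iff_existsUnique_adj.mp hdeg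
    have hH := hG.induce_compl_singleton_of_degree_eq_one hdeg
    have hfv (i : Fin (q + 3)) : f i ∈ ({v}ᶜ : Set V) := by
      rintro rfl
      have := (two_le_degree_of_cycleGraph_embedding f i).1
      omega
    let f' : cycleGraph (q + 3) ↪g G.induce {v}ᶜ :=
      ⟨⟨fun i => ⟨f i, hfv i⟩, fun i j h => f.injective (congrArg Subtype.val h)⟩,
        f.map_adj_iff⟩
    have hcard' : Fintype.card ({v}ᶜ : Set V) = q + 3 + n := by
      rw [Fintype.card_compl_set, hcard, Fintype.card_unique]
      omega
    have hE' : (G.induce {v}ᶜ).edgeSet.ncard = Fintype.card ({v}ᶜ : Set V) := by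
      have h1 := G.card_edgeFinset_induce_compl_singleton v
      rw [G.card_edgeFinset_deleteIncidenceSet, hdeg] at h1
      rw [Set.ncard_eq_toFinset_card', hcard']
      change (G.induce {v}ᶜ).edgeFinset.card = _
      change G.edgeFinset.card = _ at hE
      omega
    rw [det_dist_add_leaf hG hvu hv hH, ih _ hH hcard' hE' f']
    push_cast
    rw [show t + 1 / 2 + (n : ℚ) / 2 = t + (n + 1) / 2 by ring]
    ring

/-- Bapat–Kirkland–Neumann: let `G` be a unicyclic graph on `p + n` vertices whose
unique cycle has length `p ≥ 3`.  If `p` is even the determinant of the distance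
matrix of `G` is `0`; if `p` is odd it equals `((p-1)(p+1)/4 + (n/2)p)·(-2)^n`. -/
theorem det_distMatrix_unicyclic {V : Type*} [Fintype V] [DecidableEq V]
    (p n : ℕ) (hp : 3 ≤ p) (G : SimpleGraph V) (hconn : G.Connected)
    (hcard : Fintype.card V = p + n)
    (hunicyclic : G.edgeSet.ncard = Fintype.card V)
    (hcyc : Nonempty (SimpleGraph.cycleGraph p ↪g G)) :
    (Even p → (distMatrix G).det = 0) ∧
    (Odd p → (distMatrix G).det =
      (((p : ℚ) - 1) * ((p : ℚ) + 1) / 4 + (n : ℚ) / 2 * (p : ℚ)) *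
        (-2 : ℚ) ^ n) := by
  obtain ⟨q, rfl⟩ := Nat.exists_eq_add_of_le' hp
  obtain ⟨f⟩ := hcyc
  have h0 : distMatrix G = Matrix.of fun i j => (G.dist i j : ℚ) + 0 := by
    ext i j
    simp [distMatrix]
  rw [h0, det_dist_unicyclic q n G hconn hcard hunicyclic f, det_dist_cycleGraph]
  refine ⟨fun heven => ?_, fun hodd => ?_⟩
  · rw [det_cycle_of_even hp heven, mul_zero]
  · rw [det_cycle_of_odd hodd]
    ring
end

section
/- For every integer k ≥ 1, the determinant of the distance matrix of the cycle graph C_{2k+1} on 2k+1 vertices equals k(k+1). -/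
open SimpleGraph Matrix

open scoped Fin.CommRing in
/-- In `cycleGraph (n + 1)`, the vertices `i` and `i + m` are at distance at most `m`. -/
lemma dist_cycleGraph_add_natCast_le (n m : ℕ) (i : Fin (n + 1)) :
    (cycleGraph (n + 1)).dist i (i + (m : Fin (n + 1))) ≤ m := by
  induction m with
  | zero => simp
  | succ m ih =>
    have hstep : (cycleGraph (n + 1)).dist (i + (m : Fin (n + 1)))
        (i + ((m + 1 : ℕ) : Fin (n + 1))) ≤ 1 := by
      by_cases h : i + (m : Fin (n + 1)) = i + ((m + 1 : ℕ) : Fin (n + 1))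
      · rw [h]; simp
      · refine (dist_eq_one_iff_adj.2 ?_).le
        rw [cycleGraph_eq_circulantGraph, circulantGraph_adj]
        exact ⟨h, Or.inr (by simp)⟩
    exact (cycleGraph_connected.dist_triangle).trans (Nat.add_le_add ih hstep)

/-- The distance in a cycle graph, as a function of the difference of the two vertices. -/
lemma dist_cycleGraph (n : ℕ) (i j : Fin (n + 1)) :
    (cycleGraph (n + 1)).dist i j = min (j - i).val (n + 1 - (j - i).val) := by
  apply le_antisymm
  · have key (i j : Fin (n + 1)) : (cycleGraph (n + 1)).dist i j ≤ (j - i).val := by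
      simpa using dist_cycleGraph_add_natCast_le n (j - i).val i
    refine le_min (key i j) ?_
    rw [dist_comm]
    refine (key j i).trans ?_
    simp only [Fin.sub_def]
    have := i.isLt
    have := j.isLt
    rcases le_or_gt i.val j.val with h | h
    · rw [show n + 1 - i.val + j.val = (j.val - i.val) + (n + 1) by omega, Nat.add_mod_right,
        Nat.mod_eq_of_lt (by omega : j.val - i.val < n + 1)]
      refine (Nat.mod_le _ _).trans (by omega)
    · rw [Nat.mod_eq_of_lt (by omega : n + 1 - i.val + j.val < n + 1)]
      rw [show n + 1 - j.val + i.val = (i.val - j.val) + (n + 1) by omega, Nat.add_mod_right,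
        Nat.mod_eq_of_lt (by omega : i.val - j.val < n + 1)]
      omega
  · obtain ⟨p, hp⟩ := (cycleGraph_connected.preconnected i j).exists_walk_length_eq_dist
    rw [← hp]
    clear hp
    induction p with
    | nil => simp
    | @cons u v w h p ih =>
      rw [Walk.length_cons]
      rw [cycleGraph_eq_circulantGraph, circulantGraph_adj] at h
      have hn : 1 < n + 1 := by
        by_contra hn
        obtain rfl : n = 0 := by omega
        exact h.1 (Fin.subsingleton_one.elim _ _)
      have hval : ((1 : Fin (n + 1)) : ℕ) = 1 := by
        rw [Fin.val_one']; exact Nat.mod_eq_of_lt hn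
      have hx : w - u = (w - v) + 1 ∨ w - v = (w - u) + 1 := by
        rcases h.2 with h | h
        · right
          rw [← Set.mem_singleton_iff.1 h]; abel
        · left
          rw [← Set.mem_singleton_iff.1 h]; abel
      generalize w - u = x at *
      generalize w - v = y at *
      have := x.isLt
      have := y.isLt
      rcases hx with rfl | rfl
      all_goals
        rw [Fin.val_add_eq_ite, hval] at *
        split_ifs at * <;> omega

/-- The sum of the identity and the permutation matrix of the translation by `c`. -/
def oneAddShift (n : ℕ) (c : Fin (n + 1)) : Matrix (Fin (n + 1)) (Fin (n + 1)) ℚ :=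
  fun i j => (if j = i then 1 else 0) + (if j = i + c then 1 else 0)

lemma mul_oneAddShift_apply {n : ℕ} (c : Fin (n + 1))
    (M : Matrix (Fin (n + 1)) (Fin (n + 1)) ℚ) (i j : Fin (n + 1)) :
    (M * oneAddShift n c) i j = M i j + M i (j - c) := by
  simp only [Matrix.mul_apply, oneAddShift, mul_add, Finset.sum_add_distrib,
    ← sub_eq_iff_eq_add]
  simp

lemma mul_oneAddShift_transpose_apply {n : ℕ} (c : Fin (n + 1))
    (M : Matrix (Fin (n + 1)) (Fin (n + 1)) ℚ) (i j : Fin (n + 1)) :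
    (M * (oneAddShift n c)ᵀ) i j = M i j + M i (j + c) := by
  simp [Matrix.mul_apply, oneAddShift, mul_add, Finset.sum_add_distrib]

lemma oneAddShift_mul_apply {n : ℕ} (c : Fin (n + 1))
    (M : Matrix (Fin (n + 1)) (Fin (n + 1)) ℚ) (i j : Fin (n + 1)) :
    (oneAddShift n c * M) i j = M i j + M (i + c) j := by
  simp [Matrix.mul_apply, oneAddShift, add_mul, Finset.sum_add_distrib]

lemma det_oneAddShift_one (n : ℕ) (hn : Even n) : (oneAddShift n 1).det = 2 := by
  let U : Matrix (Fin (n + 1)) (Fin (n + 1)) ℚ :=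
    fun i j => if i ≤ j then (-1) ^ (i.val + j.val) else 0
  have hU : U.det = 1 := by
    rw [det_of_isUpperTriangular]
    · simp [U, ← two_mul]
    · intro i j hij
      exact if_neg (not_le.2 hij)
  have hL : (oneAddShift n 1 * U).det = 2 := by
    have hlast (j : Fin (n + 1)) : (oneAddShift n 1 * U) (Fin.last n) j =
        U (Fin.last n) j + (-1) ^ j.val := by
      rw [oneAddShift_mul_apply]
      simp [U]
    have hcast (i : Fin n) (j : Fin (n + 1)) : (oneAddShift n 1 * U) i.castSucc j =
        U i.castSucc j + U i.succ j := by
      rw [oneAddShift_mul_apply, Fin.coeSucc_eq_succ]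
    rw [det_of_isLowerTriangular]
    · rw [Fin.prod_univ_castSucc, hlast]
      simp only [hcast]
      simp [U, hn.neg_one_pow, ← two_mul]
    · intro i j hij
      replace hij : i < j := hij
      induction i using Fin.lastCases with
      | last => exact absurd hij (not_lt.2 (Fin.le_last j))
      | cast i =>
        have h : i.succ ≤ j := Fin.castSucc_lt_iff_succ_le.1 hij
        rw [hcast]
        simp only [U, if_pos hij.le, if_pos h, Fin.val_succ, Fin.val_castSucc]
        ring
  rw [det_mul, hU, mul_one] at hL
  exact hL

open scoped Fin.CommRing in
lemma det_oneAddShift_of_isUnit (n : ℕ) (hn : Even n) (c : Fin (n + 1)) (hc : IsUnit c) :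
    (oneAddShift n c).det = 2 := by
  obtain ⟨c, rfl⟩ := hc
  rw [← det_oneAddShift_one n hn, ← det_submatrix_equiv_self c.mulLeft]
  congr 1
  ext i j
  have h : (c : Fin (n + 1)) * j = c * i + c ↔ j = i + 1 := by
    rw [← mul_add_one, c.mul_right_inj]
  simp [oneAddShift, h]

/-- Multiplying the distance matrix of an odd cycle by `2 + Q + Q⁻¹`, where `Q` is the translation
by `k + 1`, gives `(2 * k + 1) • J - 1`, where `J` is the all-ones matrix. -/
lemma distMatrix_mul_oneAddShift_mul_transpose (k : ℕ) (c : Fin (2 * k + 1))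
    (hc : c.val = k + 1) :
    distMatrix (cycleGraph (2 * k + 1)) * oneAddShift (2 * k) c * (oneAddShift (2 * k) c)ᵀ =
      Matrix.of (fun _ _ => (2 * k + 1 : ℚ)) - 1 := by
  ext i j
  rw [mul_oneAddShift_transpose_apply, mul_oneAddShift_apply, mul_oneAddShift_apply,
    add_sub_cancel_right, Matrix.sub_apply, Matrix.of_apply, Matrix.one_apply]
  simp only [distMatrix, dist_cycleGraph]
  rw [show j - c - i = j - i - c by abel, show j + c - i = j - i + c by abel]
  have hij : i = j ↔ (j - i).val = 0 := by
    rw [Fin.val_eq_zero_iff, sub_eq_zero, eq_comm]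
  simp only [hij]
  generalize j - i = x
  have hx := x.isLt
  have hadd : (x + c).val = if x.val < k then x.val + k + 1 else x.val - k := by
    rw [Fin.val_add_eq_ite, hc]
    split_ifs <;> omega
  have hsub : (x - c).val = if x.val < k + 1 then x.val + k else x.val - (k + 1) := by
    have hval := congrArg Fin.val (sub_add_cancel x c)
    rw [Fin.val_add_eq_ite, hc] at hval
    have := (x - c).isLt
    split_ifs at * <;> omega
  clear hij
  generalize (x + c).val = y at *
  generalize (x - c).val = z at *
  generalize x.val = w at *
  rw [eq_sub_iff_add_eq]
  norm_cast
  split_ifs at * <;> omega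

lemma det_of_const_sub_one (n : ℕ) (hn : Odd n) (a : ℚ) :
    (Matrix.of (fun _ _ => a) - 1 : Matrix (Fin n) (Fin n) ℚ).det = n * a - 1 := by
  have h : (Matrix.of (fun _ _ => a) - 1 : Matrix (Fin n) (Fin n) ℚ) =
      -(1 + (replicateCol Unit (fun _ => -a) * replicateRow Unit (fun _ => (1 : ℚ)) :
        Matrix (Fin n) (Fin n) ℚ)) := by
    ext i j
    simp [Matrix.mul_apply]
    ring
  rw [h, det_neg, det_one_add_replicateCol_mul_replicateRow, Fintype.card_fin, hn.neg_one_pow]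
  simp [dotProduct]
  ring

open scoped Fin.CommRing in
/-- For every `k ≥ 1`, the determinant of the distance matrix of the odd cycle
`C_{2k+1}` equals `k(k+1)`. -/
theorem det_distMatrix_oddCycle (k : ℕ) (hk : 1 ≤ k) :
    (distMatrix (SimpleGraph.cycleGraph (2 * k + 1))).det =
      (k : ℚ) * ((k : ℚ) + 1) := by
  let c : Fin (2 * k + 1) := ⟨k + 1, by omega⟩
  have hcc : c + c = 1 := by
    ext
    rw [Fin.val_add_eq_ite, Fin.val_one', Nat.mod_eq_of_lt (by omega)]
    simp only [c]
    split_ifs <;> omega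
  have hc : IsUnit c := IsUnit.of_mul_eq_one 2 (by rw [mul_two, hcc])
  have h := congrArg Matrix.det (distMatrix_mul_oneAddShift_mul_transpose k c rfl)
  rw [det_mul, det_mul, det_transpose, det_oneAddShift_of_isUnit _ (even_two_mul k) c hc,
    det_of_const_sub_one _ ⟨k, rfl⟩] at h
  push_cast at h
  linarith
end
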